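/- arXiv:math/9607226 — 2 statements merged into one kernel-verified Lean document; each statement's English description precedes it below -/
import Mathlib

section
/- There is a function t: ℕ×ℕ → ℕ, monotone increasing in both arguments, such that whenever A ≤_i B are finite symmetric irreflexive L⁺-structures and M ∈ K contains A as a substructure, the number χ_M(B/A) of copies of B over A in M is at most t(|A|, |B|). -/
open FirstOrder Filter Topology
open scoped Classical

/-- The finite relational language with relation symbols `R i` of arity `k i`, for `i : Fin p`. -/
def Lang (p : ℕ) (k : Fin p → ℕ) : FirstOrder.Language where
  Functions := fun _ => Empty
  Relations := fun n => { i : Fin p // k i = n }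

variable {p : ℕ}

section StructureDefs

/-- The relation `R i` holds on the finite set `C` (set-version of the relation). -/
def HoldsOn (k : Fin p → ℕ) {M : Type*} [(Lang p k).Structure M]
    (i : Fin p) (C : Finset M) : Prop :=
  ∃ v : Fin (k i) → M, Function.Injective v ∧ Finset.image v Finset.univ = C ∧
    Language.Structure.RelMap (L := Lang p k) (⟨i, rfl⟩ : (Lang p k).Relations (k i)) v

/-- `w i A` : the number of `k i`-element subsets of `A` on which `R i` holds. -/
noncomputable def w (k : Fin p → ℕ) {M : Type*} [(Lang p k).Structure M]
    (i : Fin p) (A : Finset M) : ℕ :=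
  Set.ncard {C : Finset M | C ⊆ A ∧ C.card = k i ∧ HoldsOn k i C}

/-- `e(A) = Σ_i α_i · w_i(A)`. -/
noncomputable def eVal (k : Fin p → ℕ) (α : Fin p → ℝ) {M : Type*} [(Lang p k).Structure M]
    (A : Finset M) : ℝ :=
  ∑ i : Fin p, α i * (w k i A : ℝ)

/-- `δ(A) = |A| − e(A)`. -/
noncomputable def delta (k : Fin p → ℕ) (α : Fin p → ℝ) {M : Type*} [(Lang p k).Structure M]
    (A : Finset M) : ℝ :=
  (A.card : ℝ) - eVal k α A

/-- A structure is symmetric and irreflexive: relations hold only on tuples of pairwise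
distinct elements and are invariant under permutations of the tuple. -/
def SymmIrr (k : Fin p → ℕ) (M : Type*) [(Lang p k).Structure M] : Prop :=
  (∀ (n : ℕ) (r : (Lang p k).Relations n) (v : Fin n → M),
      Language.Structure.RelMap r v → Function.Injective v) ∧
  (∀ (n : ℕ) (r : (Lang p k).Relations n) (v : Fin n → M) (σ : Equiv.Perm (Fin n)),
      Language.Structure.RelMap r v → Language.Structure.RelMap r (v ∘ σ))

/-- Membership in the class `K`: a symmetric irreflexive structure all of whose finite
substructures have (hereditarily) nonnegative `δ`. -/
def InK (k : Fin p → ℕ) (α : Fin p → ℝ) (M : Type*) [(Lang p k).Structure M] : Prop :=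
  SymmIrr k M ∧ ∀ A : Finset M, 0 ≤ delta k α A

/-- A finite structure is in `K_α` if it is symmetric irreflexive and `δ(A) ≥ 0` for every
substructure. -/
def InKalpha (k : Fin p → ℕ) (α : Fin p → ℝ) (B : Type*) [(Lang p k).Structure B] : Prop :=
  SymmIrr k B ∧ ∀ S : Finset B, 0 ≤ delta k α S

/-- `d_B(X) = inf { δ(Y) : X ⊆ Y ⊆ B }` (relative version, inside the finite set `B`). -/
noncomputable def dRel (k : Fin p → ℕ) (α : Fin p → ℝ) {M : Type*} [(Lang p k).Structure M]
    (B X : Finset M) : ℝ :=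
  sInf {r : ℝ | ∃ Y : Finset M, X ⊆ Y ∧ Y ⊆ B ∧ r = delta k α Y}

/-- `A ≤_s B` for finite sets: `A ⊆ B` and `d_A(X) = d_B(X)` for all `X ⊆ A`. -/
def StrongIn (k : Fin p → ℕ) (α : Fin p → ℝ) {M : Type*} [(Lang p k).Structure M]
    (A B : Finset M) : Prop :=
  A ⊆ B ∧ ∀ X : Finset M, X ⊆ A → dRel k α A X = dRel k α B X

/-- `A ≤_i B` (intrinsic extension): there is no `A'` with `A ⊆ A' ⊊ B` and `A' ≤_s B`. -/
def IntrinsicIn (k : Fin p → ℕ) (α : Fin p → ℝ) {M : Type*} [(Lang p k).Structure M]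
    (A B : Finset M) : Prop :=
  A ⊆ B ∧ ∀ A' : Finset M, A ⊆ A' → A' ⊂ B → ¬ StrongIn k α A' B

/-- `cl^m_M(A)`: the union of all `B ⊆ M` with `A ≤_i B` and `|B − A| < m`. -/
def cl (k : Fin p → ℕ) (α : Fin p → ℝ) {M : Type*} [(Lang p k).Structure M]
    (m : ℕ) (A : Finset M) : Set M :=
  {x : M | ∃ B : Finset M, IntrinsicIn k α A B ∧ (B \ A).card < m ∧ x ∈ B}

/-- `C` and `B'` are freely joined over `A` (inside the ambient structure): they intersect in
`A` and every relation on a subset of `C ∪ B'` lives entirely inside `C` or inside `B'`. -/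
def FreelyJoined (k : Fin p → ℕ) {M : Type*} [(Lang p k).Structure M]
    (A C B' : Set M) : Prop :=
  C ∩ B' = A ∧
    ∀ (i : Fin p) (S : Finset M), ↑S ⊆ C ∪ B' → HoldsOn k i S → (↑S ⊆ C ∨ ↑S ⊆ B')

/-- `g` is an embedding (of relational structures). -/
def IsEmb (k : Fin p → ℕ) {M N : Type*} [(Lang p k).Structure M] [(Lang p k).Structure N]
    (g : M → N) : Prop :=
  Function.Injective g ∧
    ∀ (n : ℕ) (r : (Lang p k).Relations n) (v : Fin n → M),
      (Language.Structure.RelMap r (g ∘ v) ↔ Language.Structure.RelMap r v)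

/-- `g` restricted to `A` is an embedding of the substructure on `A`. -/
def IsEmbOn (k : Fin p → ℕ) {M N : Type*} [(Lang p k).Structure M] [(Lang p k).Structure N]
    (A : Finset M) (g : M → N) : Prop :=
  Set.InjOn g ↑A ∧
    ∀ (n : ℕ) (r : (Lang p k).Relations n) (v : Fin n → M), (∀ j, v j ∈ A) →
      (Language.Structure.RelMap r (g ∘ v) ↔ Language.Structure.RelMap r v)

/-- `h` restricts to an isomorphism from the induced structure on `S` onto `S'`. -/
def IsIsoOn (k : Fin p → ℕ) {M N : Type*} [(Lang p k).Structure M] [(Lang p k).Structure N]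
    (S : Set M) (S' : Set N) (h : M → N) : Prop :=
  Set.InjOn h S ∧ h '' S = S' ∧
    ∀ (n : ℕ) (r : (Lang p k).Relations n) (v : Fin n → M), (∀ j, v j ∈ S) →
      (Language.Structure.RelMap r (h ∘ v) ↔ Language.Structure.RelMap r v)

/-- A countable structure `M ∈ K` is `(K_α, ≤_s)`-semigeneric if for every `A ≤_s B` with
`B ∈ K_α` finite and every embedding `g` of `A` into `M`, and each `m`, there is an embedding
`ĝ` of `B` into `M` extending `g` whose image adds nothing to the `m`-closure of `gA` and is
freely joined with `cl^m(gA)` over `gA`. -/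
def Semigeneric (k : Fin p → ℕ) (α : Fin p → ℝ) (M : Type*) [(Lang p k).Structure M] : Prop :=
  Countable M ∧ InK k α M ∧
    ∀ (B : Type) (_ : Fintype B) (_ : (Lang p k).Structure B), InKalpha k α B →
      ∀ A : Finset B, StrongIn k α A Finset.univ →
        ∀ g : B → M, IsEmbOn k A g → ∀ m : ℕ,
          ∃ g' : B → M, IsEmb k g' ∧ (∀ a ∈ A, g' a = g a) ∧
            cl k α m (Finset.image g' Finset.univ) =
              ↑(Finset.image g' Finset.univ) ∪ cl k α m (Finset.image g A) ∧
            FreelyJoined k (↑(Finset.image g A) : Set M) (cl k α m (Finset.image g A))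
              (↑(Finset.image g' Finset.univ))

end StructureDefs

section FormulaDefs

/-- A formula is existential if it is an existential quantifier prefix applied to a
quantifier-free formula. -/
def IsExistential (k : Fin p → ℕ) {r : ℕ} (φ : (Lang p k).Formula (Fin r)) : Prop :=
  ∃ (m : ℕ) (ψ : (Lang p k).BoundedFormula (Fin r) m), ψ.IsQF ∧ φ = ψ.exs

/-- Boolean combinations of existential formulas. -/
inductive IsBoolCombExistential (k : Fin p → ℕ) {r : ℕ} :
    (Lang p k).Formula (Fin r) → Prop
  | of_existential (φ) : IsExistential k φ → IsBoolCombExistential k φ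
  | not (φ) : IsBoolCombExistential k φ → IsBoolCombExistential k φ.not
  | inf (φ ψ) : IsBoolCombExistential k φ → IsBoolCombExistential k ψ →
      IsBoolCombExistential k (φ ⊓ ψ)

end FormulaDefs

section Probability

/-- A configuration of potential relations on `{1,…,n}`: for each relation symbol, a Boolean
choice on each finite subset. -/
abbrev Config (p n : ℕ) := (i : Fin p) → Finset (Fin n) → Bool

/-- The valid configurations: `R i` may only hold on sets of size `k i`. -/
noncomputable def validE (k : Fin p → ℕ) (n : ℕ) : Finset (Config p n) :=
  Finset.univ.filter (fun E => ∀ (i : Fin p) (C : Finset (Fin n)), E i C = true → C.card = k i)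

/-- The probability of the configuration `E`: independently for each `i` and each
`k i`-element set `C`, the relation `R i` holds on `C` with probability `γ i · n^{-α i}`. -/
noncomputable def weight (k : Fin p → ℕ) (α γ : Fin p → ℝ) (n : ℕ) (E : Config p n) : ℝ :=
  ∏ i : Fin p, ∏ C ∈ Finset.univ.filter (fun C : Finset (Fin n) => C.card = k i),
    (if E i C = true then γ i * (n : ℝ) ^ (-(α i)) else 1 - γ i * (n : ℝ) ^ (-(α i)))

/-- The probability `P_n` of an event (a set of configurations). -/
noncomputable def Pev (k : Fin p → ℕ) (α γ : Fin p → ℝ) (n : ℕ)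
    (Q : Config p n → Prop) : ℝ :=
  ∑ E ∈ validE k n, if Q E then weight k α γ n E else 0

/-- The random `L⁺`-structure `G_n` on `Fin n` determined by the configuration `E`. -/
def structOf (k : Fin p → ℕ) (n : ℕ) (E : Config p n) : (Lang p k).Structure (Fin n) where
  funMap := fun {_} f _ => f.elim
  RelMap := fun {_} r v => Function.Injective v ∧ E r.1 (Finset.image v Finset.univ) = true

/-- The probability that `G_n ⊨ φ`. -/
noncomputable def Pn (k : Fin p → ℕ) (α γ : Fin p → ℝ) (n : ℕ)
    (φ : (Lang p k).Sentence) : ℝ :=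
  Pev k α γ n (fun E => letI := structOf k n E; (Fin n) ⊨ φ)

/-- The Irrationality Hypothesis: `α_0, …, α_{p−1}, 1` are linearly independent over `ℚ`. -/
def IrrHyp (α : Fin p → ℝ) : Prop :=
  LinearIndependent ℚ (Fin.snoc α (1 : ℝ) : Fin (p + 1) → ℝ)

/-- The almost sure theory `T^α`: the sentences with limit probability 1. -/
noncomputable def Talpha (k : Fin p → ℕ) (α γ : Fin p → ℝ) : (Lang p k).Theory :=
  {φ : (Lang p k).Sentence | Tendsto (fun n => Pn k α γ n φ) atTop (𝓝 1)}

/-- Auxiliary: `M`, equipped with the structure `S`, satisfies the sentence `φ`. -/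
def RealizeS (k : Fin p → ℕ) (M : Type*) (S : (Lang p k).Structure M)
    (φ : (Lang p k).Sentence) : Prop :=
  letI := S; M ⊨ φ

/-- Auxiliary: `M`, equipped with the structure `S`, is a model of the theory `T`. -/
def ModelsT (k : Fin p → ℕ) (M : Type*) (S : (Lang p k).Structure M)
    (T : (Lang p k).Theory) : Prop :=
  ∀ φ ∈ T, RealizeS k M S φ

end Probability


section Aux

variable (k : Fin p → ℕ) (α : Fin p → ℝ)

/-- The family of `k i`-element subsets of `A` on which `R i` holds. -/
def relSets {M : Type*} [(Lang p k).Structure M] (i : Fin p) (A : Finset M) :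
    Set (Finset M) :=
  {C : Finset M | C ⊆ A ∧ C.card = k i ∧ HoldsOn k i C}

variable {M : Type*} [(Lang p k).Structure M]

theorem relSets_finite (i : Fin p) (A : Finset M) : (relSets k i A).Finite :=
  (A.powerset.finite_toSet).subset fun _ hC => by
    simpa using hC.1

theorem w_le_two_pow (i : Fin p) (A : Finset M) : w k i A ≤ 2 ^ A.card := by
  have h : relSets k i A ⊆ (A.powerset : Set (Finset M)) := fun _ hC => by
    simpa using hC.1
  have h2 := Set.ncard_le_ncard h (A.powerset.finite_toSet)
  rwa [Set.ncard_coe_finset, Finset.card_powerset] at h2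

theorem w_add_le (i : Fin p) (A C : Finset M) :
    w k i A + w k i C ≤ w k i (A ∪ C) + w k i (A ∩ C) := by
  change (relSets k i A).ncard + (relSets k i C).ncard ≤
    (relSets k i (A ∪ C)).ncard + (relSets k i (A ∩ C)).ncard
  have hinter : relSets k i A ∩ relSets k i C = relSets k i (A ∩ C) := by
    ext S
    simp only [relSets, Set.mem_inter_iff, Set.mem_ofPred_eq, Finset.subset_inter_iff]
    tauto
  have hunion : relSets k i A ∪ relSets k i C ⊆ relSets k i (A ∪ C) := by
    rintro S (hS | hS)
    · exact ⟨hS.1.trans Finset.subset_union_left, hS.2⟩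
    · exact ⟨hS.1.trans Finset.subset_union_right, hS.2⟩
  rw [← Set.ncard_union_add_ncard_inter _ _ (relSets_finite k i A) (relSets_finite k i C), hinter]
  gcongr
  exact relSets_finite k i _

theorem eVal_nonneg (hα : ∀ i, 0 ≤ α i) (A : Finset M) : 0 ≤ eVal k α A :=
  Finset.sum_nonneg fun i _ => mul_nonneg (hα i) (Nat.cast_nonneg _)

theorem delta_le_card (hα : ∀ i, 0 ≤ α i) (A : Finset M) : delta k α A ≤ A.card :=
  sub_le_self _ (eVal_nonneg k α hα A)

/-- The predimension `δ` is submodular. -/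
theorem delta_union_add_delta_inter_le (hα : ∀ i, 0 ≤ α i) (A C : Finset M) :
    delta k α (A ∪ C) + delta k α (A ∩ C) ≤ delta k α A + delta k α C := by
  have hcard : ((A ∪ C).card : ℝ) + (A ∩ C).card = A.card + C.card := by
    exact_mod_cast Finset.card_union_add_card_inter A C
  have he : eVal k α A + eVal k α C ≤ eVal k α (A ∪ C) + eVal k α (A ∩ C) := by
    simp only [eVal, ← Finset.sum_add_distrib, ← mul_add]
    refine Finset.sum_le_sum fun i _ => mul_le_mul_of_nonneg_left ?_ (hα i)
    exact_mod_cast w_add_le k i A C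
  unfold delta
  linarith

variable {N : Type*} [(Lang p k).Structure N]

theorem holdsOn_image_iff {g : N → M} (hg : IsEmb k g) (i : Fin p) (C : Finset N) :
    HoldsOn k i (C.image g) ↔ HoldsOn k i C := by
  constructor
  · rintro ⟨v, hv, hvC, hR⟩
    have hmem : ∀ x, ∃ c ∈ C, g c = v x := fun x => by
      have : v x ∈ C.image g := hvC ▸ Finset.mem_image_of_mem v (Finset.mem_univ x)
      simpa using this
    choose u _ hgu using hmem
    have hcomp : g ∘ u = v := funext hgu
    refine ⟨u, ?_, ?_, ?_⟩
    · exact Function.Injective.of_comp (hcomp ▸ hv)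
    · refine Finset.image_injective hg.1 ?_
      rw [Finset.image_image, hcomp, hvC]
    · rw [← hcomp] at hR
      exact (hg.2 _ _ _).1 hR
  · rintro ⟨u, hu, huC, hR⟩
    refine ⟨g ∘ u, hg.1.comp hu, ?_, (hg.2 _ _ _).2 hR⟩
    rw [← Finset.image_image, huC]

theorem w_image {g : N → M} (hg : IsEmb k g) (i : Fin p) (A : Finset N) :
    w k i (A.image g) = w k i A := by
  have h : relSets k i (A.image g) = Finset.image g '' relSets k i A := by
    ext S
    constructor
    · rintro ⟨hSA, hcard, hR⟩
      obtain ⟨C, hCA, rfl⟩ := Finset.subset_image_iff.1 hSA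
      refine ⟨C, ⟨?_, ?_, (holdsOn_image_iff k hg i C).1 hR⟩, rfl⟩
      · exact_mod_cast hCA
      · rwa [Finset.card_image_of_injective _ hg.1] at hcard
    · rintro ⟨C, ⟨hCA, hcard, hR⟩, rfl⟩
      refine ⟨Finset.image_subset_image hCA, ?_, (holdsOn_image_iff k hg i C).2 hR⟩
      rwa [Finset.card_image_of_injective _ hg.1]
  change (relSets k i (A.image g)).ncard = (relSets k i A).ncard
  rw [h, Set.ncard_image_of_injective _ (Finset.image_injective hg.1)]

theorem delta_image {g : N → M} (hg : IsEmb k g) (A : Finset N) :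
    delta k α (A.image g) = delta k α A := by
  simp only [delta, eVal, w_image k hg, Finset.card_image_of_injective _ hg.1]

theorem strongIn_univ_of_delta_le {B : Type*} [Fintype B] [(Lang p k).Structure B]
    (hα : ∀ i, 0 ≤ α i) (A : Finset B)
    (h : ∀ Y, A ⊆ Y → delta k α A ≤ delta k α Y) : StrongIn k α A Finset.univ := by
  refine ⟨Finset.subset_univ A, fun X hX => ?_⟩
  have hbdd : ∀ Z : Finset B,
      BddBelow {r : ℝ | ∃ Y : Finset B, X ⊆ Y ∧ Y ⊆ Z ∧ r = delta k α Y} := fun Z => by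
    refine ((Set.finite_range (delta k α : Finset B → ℝ)).subset ?_).bddBelow
    rintro r ⟨Y, -, -, rfl⟩
    exact ⟨Y, rfl⟩
  apply le_antisymm
  · refine le_csInf ⟨_, X, subset_rfl, Finset.subset_univ X, rfl⟩ ?_
    rintro r ⟨Y, hXY, -, rfl⟩
    refine csInf_le_of_le (hbdd A)
      ⟨A ∩ Y, Finset.subset_inter hX hXY, Finset.inter_subset_left, rfl⟩ ?_
    have h1 := delta_union_add_delta_inter_le k α hα A Y
    have h2 := h (A ∪ Y) Finset.subset_union_left
    linarith
  · refine csInf_le_csInf (hbdd _) ⟨_, X, subset_rfl, hX, rfl⟩ ?_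
    rintro r ⟨Y, hXY, -, rfl⟩
    exact ⟨Y, hXY, Finset.subset_univ Y, rfl⟩

theorem IntrinsicIn.delta_univ_lt {B : Type*} [Fintype B] [(Lang p k).Structure B]
    (hα : ∀ i, 0 ≤ α i) {A : Finset B} (hA : IntrinsicIn k α A Finset.univ)
    {A' : Finset B} (hAA' : A ⊆ A') (hne : A' ≠ Finset.univ) :
    delta k α (Finset.univ : Finset B) < delta k α A' := by
  have hstep : ∀ Z : Finset B, A ⊆ Z → Z ≠ Finset.univ →
      ∃ Y, Z ⊆ Y ∧ delta k α Y < delta k α Z := fun Z hAZ hZ => by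
    by_contra! hcon
    exact hA.2 Z hAZ (Finset.ssubset_univ_iff.2 hZ) (strongIn_univ_of_delta_le k α hα Z hcon)
  obtain ⟨Z, hZ, hmin⟩ := Finset.exists_min_image
    (Finset.univ.filter fun Z : Finset B => A' ⊆ Z) (delta k α) ⟨A', by simp⟩
  simp only [Finset.mem_filter, Finset.mem_univ, true_and] at hZ hmin
  have hZu : Z = Finset.univ := by
    by_contra hZne
    obtain ⟨Y, hZY, hlt⟩ := hstep Z (hAA'.trans hZ) hZne
    exact (hmin Y (hZ.trans hZY)).not_gt hlt
  obtain ⟨Y, hY, hlt⟩ := hstep A' hAA' hne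
  exact hZu ▸ (hmin Y hY).trans_lt hlt

theorem exists_gap_of_finite {F : Set ℝ} (hF : F.Finite) :
    ∃ ε > 0, ∀ x ∈ F, ∀ y ∈ F, x < y → x + ε ≤ y := by
  let G : Set ℝ := insert 1 ((fun q : ℝ × ℝ => q.2 - q.1) '' {q ∈ F ×ˢ F | q.1 < q.2})
  have hG : G.Finite := (((hF.prod hF).subset (Set.sep_subset _ _)).image _).insert _
  obtain ⟨ε, hε, hmin⟩ := Set.exists_min_image G id hG ⟨1, Set.mem_insert _ _⟩
  refine ⟨ε, ?_, fun x hx y hy hxy => ?_⟩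
  · rcases hε with rfl | ⟨q, hq, rfl⟩
    · exact one_pos
    · exact sub_pos.2 hq.2
  · have := hmin (y - x) (Or.inr ⟨(x, y), ⟨⟨hx, hy⟩, hxy⟩, rfl⟩)
    simp only [id] at this
    linarith

/-- On structures with `n` elements, distinct values of `δ` are uniformly separated. -/
theorem exists_delta_gap (n : ℕ) : ∃ ε > 0, ∀ (B : Type) [Fintype B] [(Lang p k).Structure B],
    Fintype.card B = n → ∀ S T : Finset B, delta k α S < delta k α T →
      delta k α S + ε ≤ delta k α T := by
  let value : Fin (n + 1) × (Fin p → Fin (2 ^ n + 1)) → ℝ :=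
    fun q => (q.1 : ℝ) - ∑ i, α i * ((q.2 i : ℕ) : ℝ)
  obtain ⟨ε, hε, hgap⟩ := exists_gap_of_finite (Set.finite_range value)
  refine ⟨ε, hε, fun B _ _ hB S T hST => ?_⟩
  have hmem : ∀ S : Finset B, delta k α S ∈ Set.range value := fun S => by
    have hcard : S.card ≤ n := hB ▸ Finset.card_le_univ S
    refine ⟨(⟨S.card, by omega⟩, fun i => ⟨w k i S, ?_⟩), rfl⟩
    exact Nat.lt_succ_of_le ((w_le_two_pow k i S).trans (Nat.pow_le_pow_right two_pos hcard))
  exact hgap _ (hmem S) _ (hmem T) hST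

/-- A single finite set of bounded size contains every copy of an intrinsic extension. -/
theorem exists_bounded_finset_of_copies (hα : ∀ i, 0 ≤ α i) {B : Type} [Fintype B]
    [(Lang p k).Structure B] {A : Finset B} (hA : IntrinsicIn k α A Finset.univ)
    {ε : ℝ} (hε : 0 < ε)
    (hgap : ∀ S T : Finset B, delta k α S < delta k α T → delta k α S + ε ≤ delta k α T)
    (hM : ∀ S : Finset M, 0 ≤ delta k α S) (j : B → M) :
    ∃ D : Finset M, D.card ≤ Fintype.card B * (⌊Fintype.card B / ε⌋₊ + 1) ∧
      ∀ g : B → M, IsEmb k g → (∀ a ∈ A, g a = j a) → Finset.univ.image g ⊆ D := by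
  set n := Fintype.card B
  let P : ℕ → Prop := fun s => ∃ D : Finset M, A.image j ⊆ D ∧ D.card ≤ n * (s + 1) ∧
    delta k α D ≤ n - ε * s
  have hAn : (A.image j).card ≤ n := Finset.card_image_le.trans (Finset.card_le_univ A)
  have hP0 : P 0 := by
    refine ⟨A.image j, subset_rfl, by simpa using hAn, ?_⟩
    have h1 := delta_le_card k α hα (A.image j)
    have h2 : ((A.image j).card : ℝ) ≤ n := by exact_mod_cast hAn
    simp only [Nat.cast_zero, mul_zero, sub_zero]
    linarith
  have hbound : ∀ s, P s → s ≤ ⌊n / ε⌋₊ := by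
    rintro s ⟨D, -, -, hD⟩
    refine Nat.le_floor ((le_div_iff₀ hε).2 ?_)
    linarith [hM D]
  let s := Nat.findGreatest P ⌊n / ε⌋₊
  obtain ⟨D, hAD, hcard, hδ⟩ : P s := Nat.findGreatest_spec (Nat.zero_le _) hP0
  have hs : s ≤ ⌊n / ε⌋₊ := Nat.findGreatest_le _
  refine ⟨D, hcard.trans (Nat.mul_le_mul_left n (Nat.succ_le_succ hs)), fun g hg hgj => ?_⟩
  by_contra hCD
  suffices h : P (s + 1) by
    have := Nat.le_findGreatest (hbound _ h) h
    omega
  let A' : Finset B := Finset.univ.filter fun b => g b ∈ D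
  have hinter : D ∩ Finset.univ.image g = A'.image g := by
    ext x
    simp only [A', Finset.mem_inter, Finset.mem_image, Finset.mem_filter, Finset.mem_univ,
      true_and]
    constructor
    · rintro ⟨hx, b, rfl⟩
      exact ⟨b, hx, rfl⟩
    · rintro ⟨b, hb, rfl⟩
      exact ⟨hb, b, rfl⟩
  have hAA' : A ⊆ A' := fun a ha => by
    simp only [A', Finset.mem_filter, Finset.mem_univ, true_and]
    rw [hgj a ha]
    exact hAD (Finset.mem_image_of_mem j ha)
  have hne : A' ≠ Finset.univ := fun h => by
    refine hCD (Finset.image_subset_iff.2 fun b _ => ?_)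
    have : b ∈ A' := h ▸ Finset.mem_univ b
    exact (Finset.mem_filter.1 this).2
  have hlt := hgap _ _ (hA.delta_univ_lt k α hα hAA' hne)
  have hsub := delta_union_add_delta_inter_le k α hα D (Finset.univ.image g)
  rw [hinter, delta_image k α hg, delta_image k α hg] at hsub
  refine ⟨D ∪ Finset.univ.image g, hAD.trans Finset.subset_union_left, ?_, ?_⟩
  · have h1 := Finset.card_union_le D (Finset.univ.image g)
    have h2 : (Finset.univ.image g).card ≤ n := Finset.card_image_le
    linarith
  · push_cast
    linarith

end Aux

-- STATEMENT 13
theorem copies_of_intrinsic_bounded (k : Fin p → ℕ) (α : Fin p → ℝ)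
    (hα : ∀ i, 0 < α i ∧ α i ≤ 1) :
    ∃ t : ℕ → ℕ → ℕ, (∀ a a' b b', a ≤ a' → b ≤ b' → t a b ≤ t a' b') ∧
      ∀ (B : Type) [Fintype B] [(Lang p k).Structure B], SymmIrr k B →
        ∀ A : Finset B, IntrinsicIn k α A Finset.univ →
          ∀ (M : Type*) [(Lang p k).Structure M], InK k α M →
            ∀ j : B → M, IsEmbOn k A j →
              Cardinal.mk {C : Finset M | ∃ g : B → M, IsEmb k g ∧ (∀ a ∈ A, g a = j a) ∧
                  Finset.image g Finset.univ = C} ≤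
                (t A.card (Fintype.card B) : Cardinal) := by
  have hα0 : ∀ i, 0 ≤ α i := fun i => (hα i).1.le
  choose ε hε hgap using exists_delta_gap k α
  let f : ℕ → ℕ := fun n => 2 ^ (n * (⌊n / ε n⌋₊ + 1))
  refine ⟨fun _ b => ∑ i ∈ Finset.range (b + 1), f i, fun _ _ b b' _ hb => ?_, ?_⟩
  · exact Finset.sum_le_sum_of_subset (Finset.range_subset_range.2 (by omega))
  intro B _ _ _ A hA M _ hM j _
  obtain ⟨D, hcard, hD⟩ := exists_bounded_finset_of_copies k α hα0 hA (hε (Fintype.card B))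
    (hgap _ B rfl) hM.2 j
  refine (Cardinal.mk_le_mk_of_subset (t := (D.powerset : Set (Finset M))) ?_).trans ?_
  · rintro C ⟨g, hg, hgj, rfl⟩
    exact Finset.mem_coe.2 (Finset.mem_powerset.2 (hD g hg hgj))
  · rw [Finset.coe_sort_coe, Cardinal.mk_coe_finset, Finset.card_powerset]
    refine Nat.cast_le.2 ((Nat.pow_le_pow_right two_pos hcard).trans ?_)
    exact Finset.single_le_sum (f := f) (fun _ _ => Nat.zero_le _)
      (Finset.mem_range.2 (Nat.lt_succ_self _))
end

section
/- Assume the Irrationality Hypothesis. Fix finite symmetric irreflexive L⁺-structures A ⊊ B in K_α with A ≤_s B, and let v = |B − A|. There is a constant c₁ such that the probability of the following event tends to 1 as n → ∞: for every injection f of the universe of A into {1,…,n}, n^{δ(B/A)}·(log n)^{−(v+1)} < N(f, A, B) < c₁·n^{δ(B/A)}. -/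
open FirstOrder Filter Topology
open scoped Classical

variable {p : ℕ}

/-- `g` is an `L⁺`-homomorphism of `B` relative to `A` (into the configuration `E`) extending
`f`: an injection extending `f` on `A` such that every relation of `B` not contained in `A`
is sent to a relation of `G_n`. -/
def IsHomRel (k : Fin p → ℕ) {B : Type*} [(Lang p k).Structure B] {n : ℕ}
    (E : Config p n) (A : Finset B) (f g : B → Fin n) : Prop :=
  Function.Injective g ∧ (∀ a ∈ A, g a = f a) ∧
    ∀ (i : Fin p) (S : Finset B), ¬ S ⊆ A → HoldsOn k i S →
      E i (Finset.image g S) = true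

/-- The number of `L⁺`-homomorphisms of `B` relative to `A` extending `f` whose image of
`B − A` is contained in `W`. -/
noncomputable def NHomW (k : Fin p → ℕ) {B : Type*} [(Lang p k).Structure B] {n : ℕ}
    (E : Config p n) (A : Finset B) (f : B → Fin n) (W : Finset (Fin n)) : ℕ :=
  Nat.card {g : B → Fin n // IsHomRel k E A f g ∧ ∀ b : B, b ∉ A → g b ∈ W}

/-- `N(f, A, B)`: the number of `L⁺`-homomorphisms of `B` relative to `A` extending `f`. -/
noncomputable def NHom (k : Fin p → ℕ) {B : Type*} [(Lang p k).Structure B] {n : ℕ}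
    (E : Config p n) (A : Finset B) (f : B → Fin n) : ℕ :=
  Nat.card {g : B → Fin n // IsHomRel k E A f g}

/-- The expectation of `NHomW` under `P_n`. -/
noncomputable def ExpNHomW (k : Fin p → ℕ) (α γ : Fin p → ℝ) {B : Type*}
    [(Lang p k).Structure B] {n : ℕ} (A : Finset B) (f : B → Fin n)
    (W : Finset (Fin n)) : ℝ :=
  ∑ E ∈ validE k n, weight k α γ n E * (NHomW k E A f W : ℝ)


/-! ### Abstract centered moments -/

section CenteredMoments

variable {Ω T J : Type*} [DecidableEq T] [DecidableEq J]

/-- The event that all members of `D` occur, as a real-valued indicator. -/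
noncomputable def occInd {Ω T : Type*} (occ : T → Ω → Prop) (D : Finset T) (ω : Ω) : ℝ :=
  if ∀ t ∈ D, occ t ω then 1 else 0

/-- Every member of the family meets another one. -/
def EachMeets {T J : Type*} (D : J → Finset T) : Prop :=
  ∀ j, ∃ l, l ≠ j ∧ ¬ Disjoint (D j) (D l)

lemma occInd_union (occ : T → Ω → Prop) (D D' : Finset T) (ω : Ω) :
    occInd occ (D ∪ D') ω = occInd occ D ω * occInd occ D' ω := by
  simp only [occInd, Finset.mem_union, or_imp, forall_and, ite_and, ite_mul, one_mul, zero_mul]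

lemma occInd_biUnion (occ : T → Ω → Prop) (s : Finset J) (D : J → Finset T) (ω : Ω) :
    occInd occ (s.biUnion D) ω = ∏ j ∈ s, occInd occ (D j) ω := by
  induction s using Finset.induction_on with
  | empty => simp [occInd]
  | insert a s ha ih => rw [Finset.biUnion_insert, occInd_union, ih, Finset.prod_insert ha]

lemma sum_mul_prod_centered (S : Finset Ω) (wt : Ω → ℝ) (occ : T → Ω → Prop) (q : T → ℝ)
    (hq : ∀ D : Finset T, ∑ ω ∈ S, wt ω * occInd occ D ω = ∏ t ∈ D, q t)
    (D₀ : Finset T) (s : Finset J) (D : J → Finset T) :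
    ∑ ω ∈ S, wt ω * (occInd occ D₀ ω * ∏ j ∈ s, (occInd occ (D j) ω - ∏ t ∈ D j, q t)) =
      ∑ u ∈ s.powerset, (∏ t ∈ D₀ ∪ u.biUnion D, q t) * ∏ j ∈ s \ u, (-∏ t ∈ D j, q t) := by
  simp_rw [sub_eq_add_neg, Finset.prod_add, Finset.mul_sum]
  rw [Finset.sum_comm]
  refine Finset.sum_congr rfl fun u _ => ?_
  rw [← hq, Finset.sum_mul]
  refine Finset.sum_congr rfl fun ω _ => ?_
  rw [occInd_union, occInd_biUnion]
  ring

lemma prod_union_of_disjoint_biUnion {J : Type*} (q : T → ℝ) (D₀ : Finset T) (u : Finset J)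
    (D : J → Finset T) (h : ∀ j ∈ u, Disjoint D₀ (D j)) :
    ∏ t ∈ D₀ ∪ u.biUnion D, q t = (∏ t ∈ D₀, q t) * ∏ t ∈ u.biUnion D, q t :=
  Finset.prod_union ((Finset.disjoint_biUnion_right _ _ _).2 h)

lemma centered_moment_eq_zero [Fintype J] (S : Finset Ω) (wt : Ω → ℝ) (occ : T → Ω → Prop)
    (q : T → ℝ) (hq : ∀ D : Finset T, ∑ ω ∈ S, wt ω * occInd occ D ω = ∏ t ∈ D, q t)
    (D : J → Finset T) (j₀ : J) (hj : ∀ j, j ≠ j₀ → Disjoint (D j₀) (D j)) :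
    ∑ ω ∈ S, wt ω * ∏ j, (occInd occ (D j) ω - ∏ t ∈ D j, q t) = 0 := by
  have key := sum_mul_prod_centered S wt occ q hq (D j₀) (Finset.univ.erase j₀) D
  have key' := sum_mul_prod_centered S wt occ q hq ∅ (Finset.univ.erase j₀) D
  have hsplit : ∀ ω, wt ω * ∏ j, (occInd occ (D j) ω - ∏ t ∈ D j, q t) =
      wt ω * (occInd occ (D j₀) ω *
        ∏ j ∈ Finset.univ.erase j₀, (occInd occ (D j) ω - ∏ t ∈ D j, q t)) -
      (∏ t ∈ D j₀, q t) * (wt ω * (occInd occ ∅ ω *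
        ∏ j ∈ Finset.univ.erase j₀, (occInd occ (D j) ω - ∏ t ∈ D j, q t))) := by
    intro ω
    rw [← Finset.mul_prod_erase Finset.univ _ (Finset.mem_univ j₀)]
    have : occInd occ (∅ : Finset T) ω = 1 := by simp [occInd]
    rw [this]; ring
  simp_rw [hsplit]
  rw [Finset.sum_sub_distrib, ← Finset.mul_sum, key, key', Finset.mul_sum, sub_eq_zero]
  refine Finset.sum_congr rfl fun u hu => ?_
  rw [prod_union_of_disjoint_biUnion q (D j₀) u D, Finset.empty_union, mul_assoc]
  intro j hju
  exact hj j (Finset.ne_of_mem_erase (Finset.mem_powerset.1 hu hju))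

lemma prod_le_prod_of_subset_of_le_one {q : T → ℝ} (h0 : ∀ t, 0 ≤ q t) (h1 : ∀ t, q t ≤ 1)
    {D D' : Finset T} (h : D ⊆ D') : ∏ t ∈ D', q t ≤ ∏ t ∈ D, q t := by
  rw [← Finset.prod_sdiff h]
  exact mul_le_of_le_one_left (Finset.prod_nonneg fun t _ => h0 t)
    (Finset.prod_le_one (fun t _ => h0 t) fun t _ => h1 t)

lemma prod_mul_prod_le_prod_union {q : T → ℝ} (h0 : ∀ t, 0 ≤ q t) (h1 : ∀ t, q t ≤ 1)
    (D D' : Finset T) : (∏ t ∈ D, q t) * ∏ t ∈ D', q t ≤ ∏ t ∈ D ∪ D', q t := by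
  rw [← Finset.union_sdiff_self_eq_union, Finset.prod_union Finset.disjoint_sdiff]
  exact mul_le_mul_of_nonneg_left
    (prod_le_prod_of_subset_of_le_one h0 h1 Finset.sdiff_subset)
    (Finset.prod_nonneg fun t _ => h0 t)

lemma prod_prod_le_prod_biUnion {q : T → ℝ} (h0 : ∀ t, 0 ≤ q t) (h1 : ∀ t, q t ≤ 1)
    (s : Finset J) (D : J → Finset T) :
    ∏ j ∈ s, ∏ t ∈ D j, q t ≤ ∏ t ∈ s.biUnion D, q t := by
  induction s using Finset.induction_on with
  | empty => simp
  | insert a s ha ih =>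
    rw [Finset.biUnion_insert, Finset.prod_insert ha]
    exact (mul_le_mul_of_nonneg_left ih (Finset.prod_nonneg fun t _ => h0 t)).trans
      (prod_mul_prod_le_prod_union h0 h1 _ _)

lemma centered_moment_le [Fintype J] (S : Finset Ω) (wt : Ω → ℝ) (occ : T → Ω → Prop)
    (q : T → ℝ) (h0 : ∀ t, 0 ≤ q t) (h1 : ∀ t, q t ≤ 1)
    (hq : ∀ D : Finset T, ∑ ω ∈ S, wt ω * occInd occ D ω = ∏ t ∈ D, q t)
    (D : J → Finset T) :
    ∑ ω ∈ S, wt ω * ∏ j, (occInd occ (D j) ω - ∏ t ∈ D j, q t) ≤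
      2 ^ Fintype.card J * ∏ t ∈ Finset.univ.biUnion D, q t := by
  have key := sum_mul_prod_centered S wt occ q hq ∅ Finset.univ D
  have hempty : ∀ ω, occInd occ (∅ : Finset T) ω = 1 := by simp [occInd]
  simp only [hempty, one_mul, Finset.empty_union] at key
  rw [key]
  have hterm : ∀ u ∈ (Finset.univ : Finset J).powerset,
      (∏ t ∈ u.biUnion D, q t) * ∏ j ∈ Finset.univ \ u, (-∏ t ∈ D j, q t) ≤
        ∏ t ∈ Finset.univ.biUnion D, q t := by
    intro u _
    have hsplit : Finset.univ.biUnion D = u.biUnion D ∪ (Finset.univ \ u).biUnion D := by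
      rw [← Finset.union_biUnion, Finset.union_sdiff_of_subset (Finset.subset_univ u)]
    rw [hsplit]
    refine le_trans ?_ (prod_mul_prod_le_prod_union h0 h1 _ _)
    refine mul_le_mul_of_nonneg_left ?_ (Finset.prod_nonneg fun t _ => h0 t)
    refine le_trans ?_ (prod_prod_le_prod_biUnion h0 h1 _ _)
    refine (le_abs_self _).trans (le_of_eq ?_)
    rw [Finset.abs_prod]
    refine Finset.prod_congr rfl fun j _ => ?_
    rw [abs_neg, abs_of_nonneg (Finset.prod_nonneg fun t _ => h0 t)]
  refine (Finset.sum_le_card_nsmul _ _ _ hterm).trans (le_of_eq ?_)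
  simp

/-- The centered moment of a count of occurring sets is controlled by the tuples in which each
set meets another one. -/
lemma sum_centered_pow_le {ι : Type*} [Fintype ι] (S : Finset Ω) (wt : Ω → ℝ)
    (occ : T → Ω → Prop) (q : T → ℝ) (h0 : ∀ t, 0 ≤ q t) (h1 : ∀ t, q t ≤ 1)
    (hq : ∀ D : Finset T, ∑ ω ∈ S, wt ω * occInd occ D ω = ∏ t ∈ D, q t)
    (D : ι → Finset T) (m : ℕ) :
    ∑ ω ∈ S, wt ω * (∑ g, occInd occ (D g) ω - ∑ g, ∏ t ∈ D g, q t) ^ m ≤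
      2 ^ m * ∑ x : Fin m → ι, if EachMeets (fun j => D (x j)) then
        ∏ t ∈ Finset.univ.biUnion (fun j => D (x j)), q t else 0 := by
  simp_rw [← Finset.sum_sub_distrib, Fintype.sum_pow, Finset.mul_sum]
  rw [Finset.sum_comm]
  refine Finset.sum_le_sum fun x _ => ?_
  split_ifs with h
  · simpa using centered_moment_le S wt occ q h0 h1 hq (fun j => D (x j))
  · unfold EachMeets at h
    push Not at h
    obtain ⟨j, hj⟩ := h
    rw [centered_moment_eq_zero S wt occ q hq (fun j => D (x j)) j hj, mul_zero]

end CenteredMoments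

/-! ### The random structure -/

section RandomStructure

/-- The probability that the relation `R i` holds on the set `C`. -/
noncomputable def edgeProb (k : Fin p → ℕ) (α γ : Fin p → ℝ) (n : ℕ)
    (t : Fin p × Finset (Fin n)) : ℝ :=
  if t.2.card = k t.1 then γ t.1 * (n : ℝ) ^ (-(α t.1)) else 0

lemma rate_mem_Icc {α γ : ℝ} (hα : 0 < α) (hγ : 0 < γ ∧ γ ≤ 1) {n : ℕ} (hn : 1 ≤ n) :
    0 ≤ γ * (n : ℝ) ^ (-α) ∧ γ * (n : ℝ) ^ (-α) ≤ 1 := by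
  have h := Real.rpow_nonneg (Nat.cast_nonneg (α := ℝ) n) (-α)
  have h' : (n : ℝ) ^ (-α) ≤ 1 :=
    Real.rpow_le_one_of_one_le_of_nonpos (by exact_mod_cast hn) (by linarith)
  exact ⟨mul_nonneg hγ.1.le h, mul_le_one₀ hγ.2 h h'⟩

variable {k : Fin p → ℕ} {α γ : Fin p → ℝ}

lemma edgeProb_mem_Icc (hα : ∀ i, 0 < α i ∧ α i ≤ 1) (hγ : ∀ i, 0 < γ i ∧ γ i ≤ 1) {n : ℕ}
    (hn : 1 ≤ n) (t : Fin p × Finset (Fin n)) :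
    0 ≤ edgeProb k α γ n t ∧ edgeProb k α γ n t ≤ 1 := by
  unfold edgeProb
  split_ifs
  · exact rate_mem_Icc (hα _).1 (hγ _) hn
  · simp

lemma weight_nonneg (hα : ∀ i, 0 < α i ∧ α i ≤ 1) (hγ : ∀ i, 0 < γ i ∧ γ i ≤ 1) {n : ℕ}
    (hn : 1 ≤ n) (E : Config p n) : 0 ≤ weight k α γ n E := by
  refine Finset.prod_nonneg fun i _ => Finset.prod_nonneg fun C _ => ?_
  have := rate_mem_Icc (hα i).1 (hγ i) hn
  split_ifs <;> linarith [this.1, this.2]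

lemma sum_weight_mul_occInd (k : Fin p → ℕ) (α γ : Fin p → ℝ) (n : ℕ)
    (D : Finset (Fin p × Finset (Fin n))) :
    ∑ E ∈ validE k n, weight k α γ n E * occInd (fun t (E : Config p n) => E t.1 t.2 = true) D E
      = ∏ t ∈ D, edgeProb k α γ n t := by
  let h : (i : Fin p) → Finset (Fin n) → Bool → ℝ := fun i C b =>
    if b = true then edgeProb k α γ n (i, C)
    else if (i, C) ∈ D then 0 else 1 - edgeProb k α γ n (i, C)
  have hpt : ∀ E : Config p n, (if E ∈ validE k n then weight k α γ n E *
      occInd (fun t (E : Config p n) => E t.1 t.2 = true) D E else 0) =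
      ∏ i, ∏ C, h i C (E i C) := by
    intro E
    by_cases hE : E ∈ validE k n
    · have hE' := (Finset.mem_filter.1 hE).2
      rw [if_pos hE]
      by_cases hD : ∀ t ∈ D, E t.1 t.2 = true
      · rw [occInd, if_pos hD, mul_one, weight]
        refine Finset.prod_congr rfl fun i _ => ?_
        rw [Finset.prod_filter]
        refine Finset.prod_congr rfl fun C _ => ?_
        by_cases hC : E i C = true
        · simp [h, hC, edgeProb, hE' i C hC]
        · have : (i, C) ∉ D := fun hm => hC (hD _ hm)
          by_cases hc : C.card = k i <;> simp [h, hC, this, edgeProb, hc]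
      · rw [occInd, if_neg hD, mul_zero]
        push Not at hD
        obtain ⟨⟨i, C⟩, ht, hf⟩ := hD
        refine (Finset.prod_eq_zero (Finset.mem_univ i)
          (Finset.prod_eq_zero (Finset.mem_univ C) ?_)).symm
        simp only [h, if_neg hf, if_pos ht]
    · rw [if_neg hE]
      simp only [validE, Finset.mem_filter, Finset.mem_univ, true_and, not_forall] at hE
      obtain ⟨i, C, hC, hc⟩ := hE
      refine (Finset.prod_eq_zero (Finset.mem_univ i)
        (Finset.prod_eq_zero (Finset.mem_univ C) ?_)).symm
      simp [h, hC, edgeProb, hc]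
  have hsum : ∑ E ∈ validE k n, weight k α γ n E *
      occInd (fun t (E : Config p n) => E t.1 t.2 = true) D E =
      ∑ E : Config p n, ∏ i, ∏ C, h i C (E i C) := by
    rw [← Finset.sum_congr rfl fun E _ => hpt E, Finset.sum_ite_mem, Finset.univ_inter]
  rw [hsum]
  have houter := Finset.prod_univ_sum (R := ℝ) (fun _ : Fin p => (Finset.univ :
    Finset (Finset (Fin n) → Bool))) (fun i x => ∏ C, h i C (x C))
  have hinner : ∀ i, ∑ x : Finset (Fin n) → Bool, ∏ C, h i C (x C) =
      ∏ C, ∑ b, h i C b := by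
    intro i
    have := Finset.prod_univ_sum (R := ℝ) (fun _ : Finset (Fin n) => (Finset.univ :
      Finset Bool)) (fun C b => h i C b)
    rw [this, Fintype.piFinset_univ]
  rw [Fintype.piFinset_univ] at houter
  refine houter.symm.trans ((Finset.prod_congr rfl fun i _ => hinner i).trans ?_)
  have hb : ∀ i C, ∑ b, h i C b = if (i, C) ∈ D then edgeProb k α γ n (i, C) else 1 := by
    intro i C
    by_cases hm : (i, C) ∈ D <;> simp [h, hm]
  simp_rw [hb]
  rw [← Fintype.prod_prod_type' (f := fun i C => if (i, C) ∈ D then edgeProb k α γ n (i, C) else 1),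
    Finset.prod_ite_mem, Finset.univ_inter]

lemma sum_weight (k : Fin p → ℕ) (α γ : Fin p → ℝ) (n : ℕ) :
    ∑ E ∈ validE k n, weight k α γ n E = 1 := by
  simpa [occInd] using sum_weight_mul_occInd k α γ n ∅

end RandomStructure

/-! ### Relative edges and extensions -/

section Extensions

variable {B : Type*} [Fintype B] {n : ℕ}

/-- The pairs `(i, S)` such that `R i` holds on `S` and `S` is not contained in `A`. -/
noncomputable def relEdges (k : Fin p → ℕ) [(Lang p k).Structure B] (A : Finset B) :
    Finset (Fin p × Finset B) :=
  Finset.univ.filter fun e => HoldsOn k e.1 e.2 ∧ ¬ e.2 ⊆ A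

/-- The image of an edge under a map of vertices. -/
noncomputable def mapEdge (g : B → Fin n) (e : Fin p × Finset B) : Fin p × Finset (Fin n) :=
  (e.1, e.2.image g)

/-- The injections of the universe of `B` agreeing with `f` on `A`. -/
noncomputable def extInj (A : Finset B) (f : B → Fin n) : Finset (B → Fin n) :=
  Finset.univ.filter fun g => Function.Injective g ∧ ∀ a ∈ A, g a = f a

/-- The elements outside `A` which `g` sends into `H`. -/
noncomputable def overlap (A : Finset B) (g : B → Fin n) (H : Finset (Fin n)) : Finset B :=
  Finset.univ.filter fun b => b ∉ A ∧ g b ∈ H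

/-- The vertices used by the members of the tuple `x` that come after position `j`. -/
noncomputable def vertsAfter {m : ℕ} (x : Fin m → B → Fin n) (j : Fin m) : Finset (Fin n) :=
  (Finset.univ.filter fun l => j < l).biUnion fun l => Finset.univ.image (x l)

lemma HoldsOn.card_eq {k : Fin p → ℕ} {M : Type*} [(Lang p k).Structure M] {i : Fin p}
    {C : Finset M} (h : HoldsOn k i C) : C.card = k i := by
  obtain ⟨v, hv, rfl, _⟩ := h
  rw [Finset.card_image_of_injective _ hv, Finset.card_univ, Fintype.card_fin]

lemma mem_extInj {A : Finset B} {f g : B → Fin n} :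
    g ∈ extInj A f ↔ Function.Injective g ∧ ∀ a ∈ A, g a = f a := by
  simp [extInj]

lemma mem_overlap {A : Finset B} {g : B → Fin n} {H : Finset (Fin n)} {b : B} :
    b ∈ overlap A g H ↔ b ∉ A ∧ g b ∈ H := by
  simp [overlap]

lemma mem_vertsAfter {m : ℕ} {x : Fin m → B → Fin n} {j : Fin m} {u : Fin n} :
    u ∈ vertsAfter x j ↔ ∃ l, j < l ∧ ∃ b, x l b = u := by
  simp [vertsAfter]

lemma mem_relEdges {k : Fin p → ℕ} [(Lang p k).Structure B] {A : Finset B}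
    {e : Fin p × Finset B} : e ∈ relEdges k A ↔ HoldsOn k e.1 e.2 ∧ ¬ e.2 ⊆ A := by
  simp [relEdges]

lemma mapEdge_injective {B : Type*} {g : B → Fin n} (hg : Function.Injective g) :
    Function.Injective (mapEdge (p := p) g) := by
  rintro ⟨i, S⟩ ⟨i', S'⟩ h
  simp only [mapEdge, Prod.mk.injEq] at h
  exact Prod.ext h.1 (Finset.image_injective hg h.2)

lemma isHomRel_iff {k : Fin p → ℕ} [(Lang p k).Structure B] {E : Config p n} {A : Finset B}
    {f g : B → Fin n} : IsHomRel k E A f g ↔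
      g ∈ extInj A f ∧ ∀ t ∈ (relEdges k A).image (mapEdge g), E t.1 t.2 = true := by
  simp only [IsHomRel, mem_extInj, and_assoc, Finset.forall_mem_image, mem_relEdges, mapEdge,
    Prod.forall, and_imp]
  refine and_congr_right fun _ => and_congr_right fun _ => ?_
  exact forall_congr' fun i => forall_congr' fun S => ⟨fun h h1 h2 => h h2 h1,
    fun h h1 h2 => h h2 h1⟩

lemma exists_common_vertex {k : Fin p → ℕ} [(Lang p k).Structure B] {A : Finset B}
    {f g g' : B → Fin n} (hg : g ∈ extInj A f) (hg' : g' ∈ extInj A f)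
    (h : ¬ Disjoint ((relEdges k A).image (mapEdge g)) ((relEdges k A).image (mapEdge g'))) :
    ∃ b, b ∉ A ∧ ∃ b', b' ∉ A ∧ g b = g' b' := by
  rw [mem_extInj] at hg hg'
  obtain ⟨t, ht, ht'⟩ := Finset.not_disjoint_iff.1 h
  obtain ⟨⟨i, S⟩, hS, rfl⟩ := Finset.mem_image.1 ht
  obtain ⟨⟨i', S'⟩, hS', he⟩ := Finset.mem_image.1 ht'
  simp only [mapEdge, Prod.mk.injEq] at he
  obtain ⟨b, hbS, hbA⟩ := Finset.not_subset.1 (mem_relEdges.1 hS).2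
  have hb : g b ∈ S'.image g' := he.2 ▸ Finset.mem_image_of_mem g hbS
  obtain ⟨b', -, hb'⟩ := Finset.mem_image.1 hb
  refine ⟨b, hbA, b', fun hA => hbA ?_, hb'.symm⟩
  rw [hg'.2 b' hA, ← hg.2 b' hA] at hb'
  exact hg.1 hb' ▸ hA

/-- In a tuple where each extension shares an edge with another one, a fixed proportion of the
extensions overlap the later ones. -/
lemma length_le_card_overlapping {k : Fin p → ℕ} [(Lang p k).Structure B] {A : Finset B}
    {f : B → Fin n} {m : ℕ} (x : Fin m → B → Fin n) (hx : ∀ j, x j ∈ extInj A f)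
    (hmeet : EachMeets fun j => (relEdges k A).image (mapEdge (x j))) :
    m ≤ (Finset.univ.filter fun j => overlap A (x j) (vertsAfter x j) ≠ ∅).card *
      ((Finset.univ \ A).card + 1) := by
  set Q := Finset.univ.filter fun j => overlap A (x j) (vertsAfter x j) ≠ ∅ with hQ
  set P := Finset.univ.filter fun j => ¬ overlap A (x j) (vertsAfter x j) ≠ ∅ with hP
  have hcard : Q.card + P.card = m := by
    rw [hQ, hP, Finset.card_filter_add_card_filter_not, Finset.card_univ, Fintype.card_fin]
  have hlater : ∀ j l, j < l → ∀ b, b ∉ A → ∀ b', x j b = x l b' → j ∈ Q := by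
    intro j l hjl b hb b' hbb
    refine Finset.mem_filter.2 ⟨Finset.mem_univ _, Finset.nonempty_iff_ne_empty.1 ⟨b, ?_⟩⟩
    exact mem_overlap.2 ⟨hb, mem_vertsAfter.2 ⟨l, hjl, b', hbb.symm⟩⟩
  have hPQ : ∀ j ∈ P, j ∉ Q := fun j hj hj' =>
    (Finset.mem_filter.1 hj).2 (Finset.mem_filter.1 hj').2
  have hle : P.card ≤ (Q ×ˢ (Finset.univ \ A)).card := by
    refine Finset.card_le_card_of_forall_subsingleton
      (fun j lb => ∃ b, b ∉ A ∧ x j b = x lb.1 lb.2) ?_ ?_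
    · intro j hj
      obtain ⟨l, hlj, hd⟩ := hmeet j
      obtain ⟨b, hb, b', hb', hbb⟩ := exists_common_vertex (hx j) (hx l) hd
      refine ⟨(l, b'), ?_, b, hb, hbb⟩
      rcases lt_or_gt_of_ne hlj with hlt | hgt
      · exact Finset.mem_product.2 ⟨hlater l j hlt b' hb' b hbb.symm, by simpa using hb'⟩
      · exact absurd (hlater j l hgt b hb b' hbb) (hPQ j hj)
    · rintro ⟨l, b'⟩ - j ⟨hj, b, hb, hjb⟩ j' ⟨hj', c, hc, hjc⟩
      rcases lt_trichotomy j j' with hlt | heq | hgt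
      · exact absurd (hlater j j' hlt b hb c (hjb.trans hjc.symm)) (hPQ j hj)
      · exact heq
      · exact absurd (hlater j' j hgt c hc b (hjc.trans hjb.symm)) (hPQ j' hj')
  rw [Finset.card_product] at hle
  calc m = Q.card + P.card := hcard.symm
    _ ≤ Q.card + Q.card * (Finset.univ \ A).card := by gcongr
    _ = Q.card * ((Finset.univ \ A).card + 1) := by ring

/-- The product of the probabilities of the relations of `B` not contained in `A`. -/
noncomputable def relProb (k : Fin p → ℕ) [(Lang p k).Structure B] (α γ : Fin p → ℝ) (n : ℕ)
    (A : Finset B) : ℝ :=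
  ∏ e ∈ relEdges k A, γ e.1 * (n : ℝ) ^ (-(α e.1))

lemma prod_edgeProb_image {k : Fin p → ℕ} [(Lang p k).Structure B] (α γ : Fin p → ℝ)
    (A : Finset B) {g : B → Fin n} (hg : Function.Injective g) :
    ∏ t ∈ (relEdges k A).image (mapEdge g), edgeProb k α γ n t = relProb k α γ n A := by
  rw [Finset.prod_image fun e _ e' _ h => mapEdge_injective hg h]
  refine Finset.prod_congr rfl fun e he => ?_
  have := (mem_relEdges.1 he).1.card_eq
  simp [edgeProb, mapEdge, Finset.card_image_of_injective _ hg, this]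

lemma relProb_nonneg {k : Fin p → ℕ} [(Lang p k).Structure B] {α γ : Fin p → ℝ}
    (hγ : ∀ i, 0 < γ i ∧ γ i ≤ 1) (n : ℕ) (A : Finset B) : 0 ≤ relProb k α γ n A :=
  Finset.prod_nonneg fun e _ =>
    mul_nonneg (hγ e.1).1.le (Real.rpow_nonneg (Nat.cast_nonneg _) _)

lemma prod_edgeProb_biUnion_le {k : Fin p → ℕ} [(Lang p k).Structure B] {α γ : Fin p → ℝ}
    (hα : ∀ i, 0 < α i ∧ α i ≤ 1) (hγ : ∀ i, 0 < γ i ∧ γ i ≤ 1) (hn : 1 ≤ n) {A : Finset B}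
    {f : B → Fin n} {m : ℕ} (x : Fin m → B → Fin n) (hx : ∀ j, x j ∈ extInj A f) :
    ∏ t ∈ Finset.univ.biUnion (fun j => (relEdges k A).image (mapEdge (x j))),
      edgeProb k α γ n t ≤
    ∏ j, relProb k α γ n (A ∪ overlap A (x j) (vertsAfter x j)) := by
  set D' : Fin m → Finset (Fin p × Finset (Fin n)) := fun j =>
    (relEdges k (A ∪ overlap A (x j) (vertsAfter x j))).image (mapEdge (x j)) with hD'
  have hsub : Finset.univ.biUnion D' ⊆
      Finset.univ.biUnion (fun j => (relEdges k A).image (mapEdge (x j))) := by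
    refine Finset.biUnion_mono fun j _ => Finset.image_subset_image fun e he => ?_
    rw [mem_relEdges] at he ⊢
    exact ⟨he.1, fun h => he.2 (h.trans Finset.subset_union_left)⟩
  have hlt : ∀ j l, j < l → Disjoint (D' j) (D' l) := by
    intro j l hjl
    rw [Finset.disjoint_left]
    intro t ht ht'
    obtain ⟨⟨i, S⟩, hS, rfl⟩ := Finset.mem_image.1 ht
    obtain ⟨⟨i', S'⟩, hS', he⟩ := Finset.mem_image.1 ht'
    simp only [mapEdge, Prod.mk.injEq] at he
    obtain ⟨b, hbS, hb⟩ := Finset.not_subset.1 (mem_relEdges.1 hS).2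
    rw [Finset.mem_union, not_or] at hb
    have hb' : x j b ∈ S'.image (x l) := he.2 ▸ Finset.mem_image_of_mem _ hbS
    obtain ⟨b', -, hb'⟩ := Finset.mem_image.1 hb'
    exact hb.2 (mem_overlap.2 ⟨hb.1, mem_vertsAfter.2 ⟨l, hjl, b', hb'⟩⟩)
  have hdisj : ((Finset.univ : Finset (Fin m)) : Set (Fin m)).PairwiseDisjoint D' := by
    intro j _ l _ hjl
    rcases lt_or_gt_of_ne hjl with h | h
    · exact hlt j l h
    · exact (hlt l j h).symm
  refine (prod_le_prod_of_subset_of_le_one (fun t => (edgeProb_mem_Icc hα hγ hn t).1)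
    (fun t => (edgeProb_mem_Icc hα hγ hn t).2) hsub).trans (le_of_eq ?_)
  rw [Finset.prod_biUnion hdisj]
  exact Finset.prod_congr rfl fun j _ => prod_edgeProb_image α γ _ (mem_extInj.1 (hx j)).1

lemma card_vertsAfter_le {m : ℕ} (x : Fin m → B → Fin n) (j : Fin m) :
    (vertsAfter x j).card ≤ m * Fintype.card B := by
  refine Finset.card_biUnion_le.trans ((Finset.sum_le_card_nsmul _ _ (Fintype.card B)
    fun l _ => Finset.card_image_le).trans ?_)
  rw [smul_eq_mul]
  exact Nat.mul_le_mul_right _ ((Finset.card_le_univ _).trans (Fintype.card_fin m).le)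

lemma sum_tuples_le {ι : Type*} [Fintype ι] (val : ι → B → Fin n)
    (F : (B → Fin n) → Finset (Fin n) → ℝ) (hF : ∀ g H, 0 ≤ F g H) (K : ℕ) (c : ℝ)
    (hc : ∀ H : Finset (Fin n), H.card ≤ K → ∑ g, F (val g) H ≤ c) (m : ℕ)
    (hm : m * Fintype.card B ≤ K) :
    ∑ x : Fin m → ι, ∏ j, F (val (x j)) (vertsAfter (fun l => val (x l)) j) ≤ c ^ m := by
  have hc0 : 0 ≤ c := (Finset.sum_nonneg fun g _ => hF (val g) ∅).trans (hc ∅ (by simp))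
  induction m with
  | zero => simp
  | succ m ih =>
    rw [← (Fin.consEquiv fun _ => ι).sum_comp, Fintype.sum_prod_type, Finset.sum_comm, pow_succ]
    have hm' : m * Fintype.card B ≤ K := (Nat.mul_le_mul_right _ m.le_succ).trans hm
    refine le_trans ?_ (mul_le_mul_of_nonneg_right (ih hm') hc0)
    rw [Finset.sum_mul]
    refine Finset.sum_le_sum fun y _ => ?_
    have hsucc : ∀ (g : ι) (j : Fin m),
        vertsAfter (fun l => val (Fin.cons (α := fun _ => ι) g y l)) j.succ =
          vertsAfter (fun l => val (y l)) j := by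
      intro g j
      ext u
      simp [mem_vertsAfter, Fin.exists_fin_succ]
    have hzero : ∀ g g' : ι,
        vertsAfter (fun l => val (Fin.cons (α := fun _ => ι) g y l)) 0 =
          vertsAfter (fun l => val (Fin.cons (α := fun _ => ι) g' y l)) 0 := by
      intro g g'
      ext u
      simp [mem_vertsAfter, Fin.exists_fin_succ]
    simp only [Fin.consEquiv, Equiv.coe_fn_mk, Fin.prod_univ_succ, Fin.cons_zero, Fin.cons_succ,
      hsucc]
    rw [← Finset.sum_mul, mul_comm]
    refine mul_le_mul_of_nonneg_left ?_ (Finset.prod_nonneg fun j _ => hF _ _)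
    rcases isEmpty_or_nonempty ι with h | ⟨⟨g₀⟩⟩
    · simpa using hc0
    · rw [Finset.sum_congr rfl fun g _ => (by rw [hzero g g₀])]
      exact hc _ ((card_vertsAfter_le _ _).trans hm)

lemma card_overlap_eq_le (A : Finset B) (f : B → Fin n) (H : Finset (Fin n)) (X : Finset B)
    (hX : X ⊆ Finset.univ \ A) :
    ((extInj A f).filter fun g => overlap A g H = X).card ≤
      H.card ^ X.card * n ^ ((Finset.univ \ A).card - X.card) := by
  have hsub : ((extInj A f).filter fun g => overlap A g H = X) ⊆
      Fintype.piFinset fun b => if b ∈ A then {f b} else if b ∈ X then H else Finset.univ := by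
    intro g hg
    obtain ⟨hgA, rfl⟩ := Finset.mem_filter.1 hg
    rw [Fintype.mem_piFinset]
    intro b
    split_ifs with h1 h2
    · simpa using (mem_extInj.1 hgA).2 b h1
    · exact (mem_overlap.1 h2).2
    · exact Finset.mem_univ _
  refine (Finset.card_le_card hsub).trans (le_of_eq ?_)
  rw [Fintype.card_piFinset]
  have hprod : ∀ b, (if b ∈ A then {f b} else if b ∈ X then H else Finset.univ).card =
      if b ∈ A then 1 else if b ∈ X then H.card else n := by
    intro b
    split_ifs <;> simp
  simp_rw [hprod]
  rw [Finset.prod_ite, Finset.prod_const_one, one_mul, Finset.prod_ite, Finset.prod_const,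
    Finset.prod_const]
  have h1 : ((Finset.univ.filter fun b => b ∉ A).filter fun b => b ∈ X) = X := by
    ext b
    simp only [Finset.mem_filter, Finset.mem_univ, true_and, and_iff_right_iff_imp]
    exact fun hb => (Finset.mem_sdiff.1 (hX hb)).2
  have h2 : ((Finset.univ.filter fun b => b ∉ A).filter fun b => b ∉ X) =
      (Finset.univ \ A) \ X := by
    ext b
    simp
  rw [h1, h2, Finset.card_sdiff_of_subset hX]

end Extensions

/-! ### Estimates -/

section Estimates

variable {B : Type*} [Fintype B] {n : ℕ}

lemma eVal_eq_sum (k : Fin p → ℕ) [(Lang p k).Structure B] (α : Fin p → ℝ) (Y : Finset B) :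
    eVal k α Y =
      ∑ e ∈ Finset.univ.filter (fun e : Fin p × Finset B => HoldsOn k e.1 e.2 ∧ e.2 ⊆ Y),
        α e.1 := by
  rw [Finset.sum_filter, Fintype.sum_prod_type, eVal]
  refine Finset.sum_congr rfl fun i _ => ?_
  have hset : {C : Finset B | C ⊆ Y ∧ C.card = k i ∧ HoldsOn k i C} =
      ((Finset.univ.filter fun C : Finset B => HoldsOn k i C ∧ C ⊆ Y : Finset (Finset B)) :
        Set (Finset B)) := by
    ext C
    simp only [Set.mem_ofPred_eq, Finset.coe_filter, Finset.mem_univ, true_and]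
    exact ⟨fun h => ⟨h.2.2, h.1⟩, fun h => ⟨h.2, h.1.card_eq, h.1⟩⟩
  rw [w, hset, Set.ncard_coe_finset, ← Finset.sum_filter]
  simp only [Finset.sum_const, nsmul_eq_mul, mul_comm]

lemma sum_relEdges (k : Fin p → ℕ) [(Lang p k).Structure B] (α : Fin p → ℝ) (Y : Finset B) :
    ∑ e ∈ relEdges k Y, α e.1 = eVal k α (Finset.univ : Finset B) - eVal k α Y := by
  rw [eVal_eq_sum, eVal_eq_sum, eq_sub_iff_add_eq]
  simp only [Finset.subset_univ, and_true, relEdges]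
  rw [← Finset.filter_filter, ← Finset.filter_filter, add_comm, Finset.sum_filter_add_sum_filter_not]

lemma prod_rpow_relEdges (k : Fin p → ℕ) [(Lang p k).Structure B] (α : Fin p → ℝ)
    (hn : 1 ≤ n) (Y : Finset B) :
    ∏ e ∈ relEdges k Y, (n : ℝ) ^ (-(α e.1)) =
      (n : ℝ) ^ (-(eVal k α (Finset.univ : Finset B) - eVal k α Y)) := by
  rw [← sum_relEdges, ← Finset.sum_neg_distrib, Real.rpow_sum_of_pos (by exact_mod_cast hn)]

lemma relProb_eq (k : Fin p → ℕ) [(Lang p k).Structure B] (α γ : Fin p → ℝ)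
    (hn : 1 ≤ n) (Y : Finset B) :
    relProb k α γ n Y = (∏ e ∈ relEdges k Y, γ e.1) *
      (n : ℝ) ^ (-(eVal k α (Finset.univ : Finset B) - eVal k α Y)) := by
  rw [relProb, Finset.prod_mul_distrib, prod_rpow_relEdges k α hn]

lemma relProb_le {k : Fin p → ℕ} [(Lang p k).Structure B] {α γ : Fin p → ℝ}
    (hγ : ∀ i, 0 < γ i ∧ γ i ≤ 1) (hn : 1 ≤ n) (Y : Finset B) :
    relProb k α γ n Y ≤ (n : ℝ) ^ (-(eVal k α (Finset.univ : Finset B) - eVal k α Y)) := by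
  rw [relProb_eq k α γ hn]
  exact mul_le_of_le_one_left (Real.rpow_nonneg (Nat.cast_nonneg _) _)
    (Finset.prod_le_one (fun e _ => (hγ e.1).1.le) fun e _ => (hγ e.1).2)

/-- The weight of an extension whose overlap with a given set of vertices is `X`. -/
noncomputable def overlapWeight (k : Fin p → ℕ) [(Lang p k).Structure B] (α γ : Fin p → ℝ)
    (n : ℕ) (ε : ℝ) (A X : Finset B) : ℝ :=
  relProb k α γ n (A ∪ X) * if X = ∅ then 1 else (n : ℝ) ^ ε

lemma overlapWeight_nonneg {k : Fin p → ℕ} [(Lang p k).Structure B] {α γ : Fin p → ℝ}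
    (hγ : ∀ i, 0 < γ i ∧ γ i ≤ 1) (n : ℕ) (ε : ℝ) (A X : Finset B) :
    0 ≤ overlapWeight k α γ n ε A X := by
  refine mul_nonneg (relProb_nonneg hγ n _) ?_
  split_ifs
  · exact zero_le_one
  · exact Real.rpow_nonneg (Nat.cast_nonneg _) _

lemma pow_mul_overlapWeight_le {k : Fin p → ℕ} [(Lang p k).Structure B] {α γ : Fin p → ℝ}
    (hγ : ∀ i, 0 < γ i ∧ γ i ≤ 1) (hn : 1 ≤ n) {A : Finset B} {ε : ℝ}
    (hε : ∀ B₁ : Finset B, A ⊂ B₁ → ε ≤ delta k α B₁ - delta k α A) {X : Finset B}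
    (hX : X ⊆ Finset.univ \ A) :
    (n : ℝ) ^ ((Finset.univ \ A).card - X.card) * overlapWeight k α γ n ε A X ≤
      (n : ℝ) ^ (delta k α (Finset.univ : Finset B) - delta k α A) := by
  have hn0 : (0 : ℝ) < n := by exact_mod_cast hn
  have hn1 : (1 : ℝ) ≤ n := by exact_mod_cast hn
  have hdisj : Disjoint A X := Finset.disjoint_of_subset_right hX Finset.disjoint_sdiff
  have hcardU : ((Finset.univ \ A).card : ℝ) = (Finset.univ : Finset B).card - A.card := by
    rw [Finset.card_sdiff_of_subset (Finset.subset_univ A),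
      Nat.cast_sub (Finset.card_le_card (Finset.subset_univ A))]
  have hcardX : ((A ∪ X).card : ℝ) = A.card + X.card := by
    exact_mod_cast Finset.card_union_of_disjoint hdisj
  have hif : (if X = ∅ then (1 : ℝ) else (n : ℝ) ^ ε) ≤
      (n : ℝ) ^ (delta k α (A ∪ X) - delta k α A) := by
    split_ifs with h
    · simp [h]
    · refine Real.rpow_le_rpow_of_exponent_le hn1 (hε _ ?_)
      refine Finset.ssubset_iff_subset_ne.2 ⟨Finset.subset_union_left, fun hEq => h ?_⟩
      have : X ⊆ A := by rw [hEq]; exact Finset.subset_union_right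
      exact Finset.disjoint_self_iff_empty X |>.1 (Finset.disjoint_of_subset_left this hdisj)
  rw [← Real.rpow_natCast, Nat.cast_sub (Finset.card_le_card hX)]
  calc _ ≤ (n : ℝ) ^ (((Finset.univ \ A).card : ℝ) - X.card) *
        ((n : ℝ) ^ (-(eVal k α (Finset.univ : Finset B) - eVal k α (A ∪ X))) *
          (n : ℝ) ^ (delta k α (A ∪ X) - delta k α A)) := by
        refine mul_le_mul_of_nonneg_left ?_ (Real.rpow_nonneg hn0.le _)
        refine mul_le_mul (relProb_le hγ hn _) hif ?_ (Real.rpow_nonneg hn0.le _)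
        split_ifs
        · exact zero_le_one
        · exact Real.rpow_nonneg hn0.le _
    _ = _ := by
        rw [← Real.rpow_add hn0, ← Real.rpow_add hn0]
        congr 1
        simp only [delta]
        rw [hcardU, hcardX]
        ring

lemma sum_overlapWeight_le {k : Fin p → ℕ} [(Lang p k).Structure B] {α γ : Fin p → ℝ}
    (hγ : ∀ i, 0 < γ i ∧ γ i ≤ 1) (hn : 1 ≤ n) {A : Finset B} {ε : ℝ}
    (hε : ∀ B₁ : Finset B, A ⊂ B₁ → ε ≤ delta k α B₁ - delta k α A) (f : B → Fin n) {K : ℕ}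
    (hK : 1 ≤ K) (H : Finset (Fin n)) (hH : H.card ≤ K) :
    ∑ g ∈ extInj A f, overlapWeight k α γ n ε A (overlap A g H) ≤
      (2 * K) ^ Fintype.card B *
        (n : ℝ) ^ (delta k α (Finset.univ : Finset B) - delta k α A) := by
  have hn0 : (0 : ℝ) ≤ n := Nat.cast_nonneg _
  have hK1 : (1 : ℝ) ≤ K := by exact_mod_cast hK
  have hmaps : ∀ g ∈ extInj A f, overlap A g H ∈ (Finset.univ \ A).powerset := by
    intro g _
    refine Finset.mem_powerset.2 fun b hb => ?_
    simpa using (mem_overlap.1 hb).1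
  rw [← Finset.sum_fiberwise_of_maps_to hmaps]
  have hterm : ∀ X ∈ (Finset.univ \ A).powerset,
      ∑ g ∈ (extInj A f).filter (fun g => overlap A g H = X),
        overlapWeight k α γ n ε A (overlap A g H) ≤
      (K : ℝ) ^ Fintype.card B *
        (n : ℝ) ^ (delta k α (Finset.univ : Finset B) - delta k α A) := by
    intro X hX
    rw [Finset.mem_powerset] at hX
    rw [Finset.sum_congr rfl fun g hg => by rw [(Finset.mem_filter.1 hg).2], Finset.sum_const,
      nsmul_eq_mul]
    have hcard : (((extInj A f).filter fun g => overlap A g H = X).card : ℝ) ≤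
        (K : ℝ) ^ Fintype.card B * (n : ℝ) ^ ((Finset.univ \ A).card - X.card) := by
      have h1 : (((extInj A f).filter fun g => overlap A g H = X).card : ℝ) ≤
          (H.card : ℝ) ^ X.card * (n : ℝ) ^ ((Finset.univ \ A).card - X.card) := by
        exact_mod_cast card_overlap_eq_le A f H X hX
      refine h1.trans (mul_le_mul_of_nonneg_right ?_ (pow_nonneg hn0 _))
      calc (H.card : ℝ) ^ X.card ≤ (K : ℝ) ^ X.card := by gcongr
        _ ≤ (K : ℝ) ^ Fintype.card B := pow_le_pow_right₀ hK1 (Finset.card_le_univ X)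
    calc _ ≤ (K : ℝ) ^ Fintype.card B * (n : ℝ) ^ ((Finset.univ \ A).card - X.card) *
          overlapWeight k α γ n ε A X :=
        mul_le_mul_of_nonneg_right hcard (overlapWeight_nonneg hγ n ε A X)
      _ ≤ _ := by
        rw [mul_assoc]
        exact mul_le_mul_of_nonneg_left (pow_mul_overlapWeight_le hγ hn hε hX)
          (pow_nonneg (by linarith) _)
  refine (Finset.sum_le_card_nsmul _ _ _ hterm).trans ?_
  rw [nsmul_eq_mul, Finset.card_powerset, mul_pow, mul_assoc]
  refine mul_le_mul_of_nonneg_right ?_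
    (mul_nonneg (pow_nonneg (by linarith) _) (Real.rpow_nonneg hn0 _))
  push_cast
  exact pow_le_pow_right₀ one_le_two (Finset.card_le_univ _)

/-- Bound for the total weight of the tuples of extensions each sharing an edge with another. -/
lemma sum_meeting_tuples_le {k : Fin p → ℕ} [(Lang p k).Structure B] {α γ : Fin p → ℝ}
    (hα : ∀ i, 0 < α i ∧ α i ≤ 1) (hγ : ∀ i, 0 < γ i ∧ γ i ≤ 1) (hn : 1 ≤ n) {A : Finset B}
    {ε : ℝ} (hε0 : 0 < ε)
    (hε : ∀ B₁ : Finset B, A ⊂ B₁ → ε ≤ delta k α B₁ - delta k α A) (f : B → Fin n) (m : ℕ) :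
    ∑ x : Fin m → {g // g ∈ extInj A f},
      (if EachMeets (fun j => (relEdges k A).image (mapEdge (x j).1)) then
        ∏ t ∈ Finset.univ.biUnion (fun j => (relEdges k A).image (mapEdge (x j).1)),
          edgeProb k α γ n t else 0) ≤
      (n : ℝ) ^ (-(ε * m / ((Finset.univ \ A).card + 1))) *
        ((2 * (m * Fintype.card B + 1 : ℕ)) ^ Fintype.card B *
          (n : ℝ) ^ (delta k α (Finset.univ : Finset B) - delta k α A)) ^ m := by
  have hn0 : (0 : ℝ) < n := by exact_mod_cast hn
  have hn1 : (1 : ℝ) ≤ n := by exact_mod_cast hn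
  set F : (B → Fin n) → Finset (Fin n) → ℝ := fun g H =>
    overlapWeight k α γ n ε A (overlap A g H) with hF
  have hF0 : ∀ g H, 0 ≤ F g H := fun g H => overlapWeight_nonneg hγ n ε A _
  have hsum := sum_tuples_le (fun g : {g // g ∈ extInj A f} => g.1) F hF0
    (m * Fintype.card B + 1)
    ((2 * (m * Fintype.card B + 1 : ℕ)) ^ Fintype.card B *
          (n : ℝ) ^ (delta k α (Finset.univ : Finset B) - delta k α A))
    (fun H hH => by
      rw [Finset.sum_coe_sort (extInj A f) fun g => F g H]
      exact sum_overlapWeight_le hγ hn hε f (by omega) H hH) m (by omega)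
  refine le_trans ?_ (mul_le_mul_of_nonneg_left hsum (Real.rpow_nonneg hn0.le _))
  rw [Finset.mul_sum]
  refine Finset.sum_le_sum fun x _ => ?_
  split_ifs with hmeet
  swap
  · exact mul_nonneg (Real.rpow_nonneg hn0.le _) (Finset.prod_nonneg fun j _ => hF0 _ _)
  have hx : ∀ j, (x j).1 ∈ extInj A f := fun j => (x j).2
  have hlen := length_le_card_overlapping (fun j => (x j).1) hx hmeet
  refine (prod_edgeProb_biUnion_le hα hγ hn (fun j => (x j).1) hx).trans ?_
  simp only [hF, overlapWeight]
  rw [Finset.prod_mul_distrib, mul_left_comm]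
  refine le_mul_of_one_le_right (Finset.prod_nonneg fun j _ => relProb_nonneg hγ n _) ?_
  set Q := Finset.univ.filter fun j =>
    overlap A (x j).1 (vertsAfter (fun l => (x l).1) j) ≠ ∅ with hQ
  rw [Finset.prod_ite, Finset.prod_const_one, one_mul, Finset.prod_const]
  rw [← Real.rpow_mul_natCast hn0.le, ← Real.rpow_add hn0]
  refine Real.one_le_rpow hn1 ?_
  rw [neg_add_eq_sub, sub_nonneg, div_le_iff₀ (by positivity), mul_assoc]
  refine mul_le_mul_of_nonneg_left ?_ hε0.le
  exact_mod_cast hlen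

/-- The expected number of extensions of `f`. -/
noncomputable def meanExt (k : Fin p → ℕ) [(Lang p k).Structure B] (α γ : Fin p → ℝ) {n : ℕ}
    (A : Finset B) (f : B → Fin n) : ℝ :=
  (extInj A f).card * relProb k α γ n A

lemma nHom_eq_sum {k : Fin p → ℕ} [(Lang p k).Structure B] (E : Config p n) (A : Finset B)
    (f : B → Fin n) :
    (NHom k E A f : ℝ) = ∑ g : {g // g ∈ extInj A f},
      occInd (fun t (E : Config p n) => E t.1 t.2 = true)
        ((relEdges k A).image (mapEdge g.1)) E := by
  rw [Finset.sum_coe_sort (extInj A f) fun g =>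
    occInd (fun t (E : Config p n) => E t.1 t.2 = true) ((relEdges k A).image (mapEdge g)) E]
  have hcard : NHom k E A f = ((extInj A f).filter fun g =>
      ∀ t ∈ (relEdges k A).image (mapEdge g), E t.1 t.2 = true).card := by
    rw [NHom, Nat.card_eq_fintype_card, Fintype.card_subtype]
    congr 1
    ext g
    simp only [Finset.mem_filter, Finset.mem_univ, true_and, isHomRel_iff]
  rw [hcard, Finset.natCast_card_filter]
  refine Finset.sum_congr rfl fun g _ => ?_
  unfold occInd
  split_ifs <;> rfl

lemma moment_nHom_le {k : Fin p → ℕ} [(Lang p k).Structure B] {α γ : Fin p → ℝ}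
    (hα : ∀ i, 0 < α i ∧ α i ≤ 1) (hγ : ∀ i, 0 < γ i ∧ γ i ≤ 1) (hn : 1 ≤ n) {A : Finset B}
    {ε : ℝ} (hε0 : 0 < ε)
    (hε : ∀ B₁ : Finset B, A ⊂ B₁ → ε ≤ delta k α B₁ - delta k α A) (f : B → Fin n) (m : ℕ) :
    ∑ E ∈ validE k n, weight k α γ n E * ((NHom k E A f : ℝ) - meanExt k α γ A f) ^ m ≤
      2 ^ m * ((n : ℝ) ^ (-(ε * m / ((Finset.univ \ A).card + 1))) *
        ((2 * (m * Fintype.card B + 1 : ℕ)) ^ Fintype.card B *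
          (n : ℝ) ^ (delta k α (Finset.univ : Finset B) - delta k α A)) ^ m) := by
  have h := sum_centered_pow_le (validE k n) (weight k α γ n)
    (fun t (E : Config p n) => E t.1 t.2 = true) (edgeProb k α γ n)
    (fun t => (edgeProb_mem_Icc hα hγ hn t).1) (fun t => (edgeProb_mem_Icc hα hγ hn t).2)
    (sum_weight_mul_occInd k α γ n)
    (fun g : {g // g ∈ extInj A f} => (relEdges k A).image (mapEdge g.1)) m
  have hmean : ∑ g : {g // g ∈ extInj A f},
      ∏ t ∈ (relEdges k A).image (mapEdge g.1), edgeProb k α γ n t = meanExt k α γ A f := by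
    rw [Finset.sum_congr rfl fun g _ => prod_edgeProb_image α γ A (mem_extInj.1 g.2).1]
    simp [meanExt]
  simp_rw [hmean, ← nHom_eq_sum] at h
  exact h.trans (mul_le_mul_of_nonneg_left (sum_meeting_tuples_le hα hγ hn hε0 hε f m)
    (by positivity))

lemma card_extInj_le (A : Finset B) (f : B → Fin n) :
    (extInj A f).card ≤ n ^ (Finset.univ \ A).card := by
  have h := card_overlap_eq_le A f ∅ ∅ (Finset.empty_subset _)
  have hov : ∀ g : B → Fin n, overlap A g ∅ = ∅ := fun g => by ext b; simp [mem_overlap]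
  simpa [hov] using h

lemma le_card_extInj (A : Finset B) (f : B → Fin n) (hf : Set.InjOn f ↑A) :
    (n - Fintype.card B) ^ (Finset.univ \ A).card ≤ (extInj A f).card := by
  have hcardB : A.card + (Finset.univ \ A).card = Fintype.card B := by
    rw [add_comm, Finset.card_sdiff_add_card_eq_card (Finset.subset_univ A), Finset.card_univ]
  have hemb : Fintype.card (↥(Finset.univ \ A) ↪ ↥(Finset.univ \ A.image f)) ≤
      (extInj A f).card := by
    rw [← Finset.card_univ]
    refine Finset.card_le_card_of_injOn
      (fun φ b => if h : b ∈ Finset.univ \ A then (φ ⟨b, h⟩).1 else f b) ?_ ?_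
    · intro φ _
      have hout : ∀ b, (φ b).1 ∉ A.image f := fun b => (Finset.mem_sdiff.1 (φ b).2).2
      refine mem_extInj.2 ⟨?_, fun a ha => by simp [ha]⟩
      intro b c hbc
      by_cases hb : b ∈ Finset.univ \ A <;> by_cases hc : c ∈ Finset.univ \ A
      · simp only [dif_pos hb, dif_pos hc] at hbc
        exact congrArg Subtype.val (φ.injective (Subtype.ext hbc))
      · simp only [dif_pos hb, dif_neg hc] at hbc
        exact absurd (hbc ▸ Finset.mem_image_of_mem f (by simpa using hc)) (hout ⟨b, hb⟩)
      · simp only [dif_neg hb, dif_pos hc] at hbc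
        exact absurd (hbc ▸ Finset.mem_image_of_mem f (by simpa using hb)) (hout ⟨c, hc⟩)
      · simp only [dif_neg hb, dif_neg hc] at hbc
        exact hf (by simpa using hb) (by simpa using hc) hbc
    · intro φ _ ψ _ h
      ext ⟨b, hb⟩
      have := congrFun h b
      simp only [dif_pos hb] at this
      exact congrArg Fin.val this
  rw [Fintype.card_embedding_eq, Fintype.card_coe, Fintype.card_coe] at hemb
  refine le_trans ?_ ((Nat.pow_sub_le_descFactorial _ _).trans hemb)
  refine Nat.pow_le_pow_left ?_ _
  rw [Finset.card_sdiff_of_subset (Finset.subset_univ _), Finset.card_univ, Fintype.card_fin]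
  have := Finset.card_image_le (s := A) (f := f)
  omega

lemma rpow_delta_sub (k : Fin p → ℕ) [(Lang p k).Structure B] (α : Fin p → ℝ) (hn : 1 ≤ n)
    (A : Finset B) :
    (n : ℝ) ^ (Finset.univ \ A).card *
        (n : ℝ) ^ (-(eVal k α (Finset.univ : Finset B) - eVal k α A)) =
      (n : ℝ) ^ (delta k α (Finset.univ : Finset B) - delta k α A) := by
  have hn0 : (0 : ℝ) < n := by exact_mod_cast hn
  rw [← Real.rpow_natCast, ← Real.rpow_add hn0,
    Finset.card_sdiff_of_subset (Finset.subset_univ A),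
    Nat.cast_sub (Finset.card_le_card (Finset.subset_univ A))]
  congr 1
  simp only [delta]
  ring

lemma meanExt_le {k : Fin p → ℕ} [(Lang p k).Structure B] {α γ : Fin p → ℝ}
    (hγ : ∀ i, 0 < γ i ∧ γ i ≤ 1) (hn : 1 ≤ n) (A : Finset B) (f : B → Fin n) :
    meanExt k α γ A f ≤ (n : ℝ) ^ (delta k α (Finset.univ : Finset B) - delta k α A) := by
  rw [← rpow_delta_sub k α hn]
  refine mul_le_mul ?_ (relProb_le hγ hn A) (relProb_nonneg hγ n A) (by positivity)
  exact_mod_cast card_extInj_le A f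

lemma le_meanExt {k : Fin p → ℕ} [(Lang p k).Structure B] {α γ : Fin p → ℝ}
    (hγ : ∀ i, 0 < γ i ∧ γ i ≤ 1) (hn : 1 ≤ n) (hn' : 2 * Fintype.card B ≤ n) (A : Finset B)
    (f : B → Fin n) (hf : Set.InjOn f ↑A) :
    (∏ e ∈ relEdges k A, γ e.1) / 2 ^ (Finset.univ \ A).card *
      (n : ℝ) ^ (delta k α (Finset.univ : Finset B) - delta k α A) ≤ meanExt k α γ A f := by
  rw [← rpow_delta_sub k α hn, meanExt, relProb_eq k α γ hn]
  have hcard : ((n : ℝ) / 2) ^ (Finset.univ \ A).card ≤ (extInj A f).card := by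
    have h1 : ((n - Fintype.card B : ℕ) : ℝ) ^ (Finset.univ \ A).card ≤ (extInj A f).card := by
      exact_mod_cast le_card_extInj A f hf
    refine le_trans (pow_le_pow_left₀ (by positivity) ?_ _) h1
    have h2 : (2 : ℝ) * Fintype.card B ≤ n := by exact_mod_cast hn'
    rw [Nat.cast_sub (by omega)]
    linarith
  have hγ0 : 0 ≤ ∏ e ∈ relEdges k A, γ e.1 := Finset.prod_nonneg fun e _ => (hγ e.1).1.le
  calc _ = ((n : ℝ) / 2) ^ (Finset.univ \ A).card * ((∏ e ∈ relEdges k A, γ e.1) *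
        (n : ℝ) ^ (-(eVal k α (Finset.univ : Finset B) - eVal k α A))) := by
        rw [div_pow]; ring
    _ ≤ _ := mul_le_mul_of_nonneg_right hcard (by positivity)

lemma one_sub_sum_le_pev {k : Fin p → ℕ} {α γ : Fin p → ℝ} (hα : ∀ i, 0 < α i ∧ α i ≤ 1)
    (hγ : ∀ i, 0 < γ i ∧ γ i ≤ 1) (hn : 1 ≤ n) {ι : Type*} [Fintype ι]
    (Z : ι → Config p n → ℝ) (hZ : ∀ f E, 0 ≤ Z f E) (Q : Config p n → Prop)
    (hQ : ∀ E, ¬ Q E → ∃ f, 1 ≤ Z f E) :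
    1 - ∑ f, ∑ E ∈ validE k n, weight k α γ n E * Z f E ≤ Pev k α γ n Q := by
  rw [← sum_weight k α γ n, Finset.sum_comm, ← Finset.sum_sub_distrib, Pev]
  refine Finset.sum_le_sum fun E _ => ?_
  have hw := weight_nonneg (k := k) hα hγ hn E
  rw [← Finset.mul_sum]
  have hsum : 0 ≤ ∑ f, Z f E := Finset.sum_nonneg fun f _ => hZ f E
  split_ifs with h
  · linarith [mul_nonneg hw hsum]
  · obtain ⟨f, hf⟩ := hQ E h
    have : 1 ≤ ∑ f, Z f E :=
      hf.trans (Finset.single_le_sum (fun f _ => hZ f E) (Finset.mem_univ f))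
    linarith [mul_le_mul_of_nonneg_left this hw]

lemma pev_le_one {k : Fin p → ℕ} {α γ : Fin p → ℝ} (hα : ∀ i, 0 < α i ∧ α i ≤ 1)
    (hγ : ∀ i, 0 < γ i ∧ γ i ≤ 1) (hn : 1 ≤ n) (Q : Config p n → Prop) :
    Pev k α γ n Q ≤ 1 := by
  rw [← sum_weight k α γ n, Pev]
  refine Finset.sum_le_sum fun E _ => ?_
  split_ifs
  · exact le_rfl
  · exact weight_nonneg hα hγ hn E

/-- With probability close to one, every count of extensions deviates from its mean by less than
half of the mean. -/
lemma le_pev_forall_abs_sub_meanExt_lt {k : Fin p → ℕ} [(Lang p k).Structure B]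
    {α γ : Fin p → ℝ} (hα : ∀ i, 0 < α i ∧ α i ≤ 1) (hγ : ∀ i, 0 < γ i ∧ γ i ≤ 1) {A : Finset B}
    {ε : ℝ} (hε0 : 0 < ε)
    (hε : ∀ B₁ : Finset B, A ⊂ B₁ → ε ≤ delta k α B₁ - delta k α A) :
    ∃ C : ℝ, ∀ n : ℕ, 1 ≤ n → 2 * Fintype.card B ≤ n →
      1 - C * (n : ℝ)⁻¹ ≤ Pev k α γ n fun E => ∀ f : B → Fin n, Set.InjOn f ↑A →
        |(NHom k E A f : ℝ) - meanExt k α γ A f| < meanExt k α γ A f / 2 := by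
  set v := (Finset.univ \ A).card with hv
  set d := delta k α (Finset.univ : Finset B) - delta k α A with hd
  set c := (∏ e ∈ relEdges k A, γ e.1) / 2 ^ v with hc
  have hc0 : 0 < c := div_pos (Finset.prod_pos fun e _ => (hγ e.1).1) (by positivity)
  obtain ⟨r, hr⟩ := exists_nat_ge ((Fintype.card B + 1 : ℝ) * (v + 1) / ε)
  set m := 2 * r with hm
  set K : ℝ := (2 * (m * Fintype.card B + 1 : ℕ)) ^ Fintype.card B with hK
  have hK0 : 0 ≤ K := by positivity
  refine ⟨2 ^ m * K ^ m / (c / 2) ^ m, fun n hn hn' => ?_⟩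
  have hn0 : (0 : ℝ) < n := by exact_mod_cast hn
  have hn1 : (1 : ℝ) ≤ n := by exact_mod_cast hn
  have hnd : 0 < (n : ℝ) ^ d := Real.rpow_pos_of_pos hn0 _
  have heven : Even m := even_two_mul r
  have hμ : ∀ f : B → Fin n, Set.InjOn f ↑A → c * (n : ℝ) ^ d ≤ meanExt k α γ A f :=
    fun f hf => le_meanExt hγ hn hn' A f hf
  let Z : (B → Fin n) → Config p n → ℝ := fun f E => if Set.InjOn f ↑A then
    ((NHom k E A f : ℝ) - meanExt k α γ A f) ^ m / (meanExt k α γ A f / 2) ^ m else 0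
  have hZ : ∀ f E, 0 ≤ Z f E := by
    intro f E
    simp only [Z]
    split_ifs
    · exact div_nonneg (heven.pow_nonneg _) (heven.pow_nonneg _)
    · exact le_rfl
  refine le_trans ?_ (one_sub_sum_le_pev hα hγ hn Z hZ _ ?_)
  · refine sub_le_sub_left ?_ _
    have hexp : (n : ℝ) ^ (-(ε * m / (v + 1))) ≤ (n : ℝ) ^ (-(Fintype.card B + 1 : ℝ)) := by
      refine Real.rpow_le_rpow_of_exponent_le hn1 (neg_le_neg ?_)
      rw [le_div_iff₀ (by positivity)]
      rw [div_le_iff₀ hε0] at hr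
      have : (m : ℝ) = 2 * r := by rw [hm]; push_cast; ring
      rw [this]
      nlinarith [mul_nonneg (Nat.cast_nonneg (α := ℝ) r) hε0.le]
    have hterm : ∀ f ∈ (Finset.univ : Finset (B → Fin n)),
        ∑ E ∈ validE k n, weight k α γ n E * Z f E ≤
          2 ^ m * K ^ m / (c / 2) ^ m * (n : ℝ) ^ (-(Fintype.card B + 1 : ℝ)) := by
      intro f _
      by_cases hf : Set.InjOn f ↑A
      · simp only [Z, if_pos hf, ← mul_div_assoc]
        rw [← Finset.sum_div, div_le_iff₀ (pow_pos (by linarith [hμ f hf, mul_pos hc0 hnd]) _)]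
        refine (moment_nHom_le hα hγ hn hε0 hε f m).trans ?_
        calc 2 ^ m * ((n : ℝ) ^ (-(ε * m / (v + 1))) * (K * (n : ℝ) ^ d) ^ m)
            ≤ 2 ^ m * ((n : ℝ) ^ (-(Fintype.card B + 1 : ℝ)) * (K * (n : ℝ) ^ d) ^ m) := by
              gcongr
          _ = 2 ^ m * K ^ m / (c / 2) ^ m * (n : ℝ) ^ (-(Fintype.card B + 1 : ℝ)) *
                (c * (n : ℝ) ^ d / 2) ^ m := by
              rw [show c * (n : ℝ) ^ d / 2 = c / 2 * (n : ℝ) ^ d by ring, mul_pow, mul_pow]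
              field_simp
          _ ≤ _ := by
              gcongr
              exact hμ f hf
      · simp only [Z, if_neg hf, mul_zero, Finset.sum_const_zero]
        positivity
    refine (Finset.sum_le_card_nsmul _ _ _ hterm).trans (le_of_eq ?_)
    rw [nsmul_eq_mul, Finset.card_univ, Fintype.card_fun, Fintype.card_fin, Nat.cast_pow,
      mul_left_comm, ← Real.rpow_natCast (n : ℝ), ← Real.rpow_add hn0, ← Real.rpow_neg_one]
    congr 2
    ring
  · intro E hE
    push Not at hE
    obtain ⟨f, hf, hE⟩ := hE
    refine ⟨f, ?_⟩
    have hpos : 0 < meanExt k α γ A f / 2 := by linarith [hμ f hf, mul_pos hc0 hnd]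
    simp only [Z, if_pos hf]
    rw [one_le_div (pow_pos hpos _), ← heven.pow_abs ((NHom k E A f : ℝ) - _)]
    exact pow_le_pow_left₀ hpos.le hE _

lemma exists_pos_le_delta_sub (k : Fin p → ℕ) [(Lang p k).Structure B] (α : Fin p → ℝ)
    (A : Finset B) (hstrong : ∀ B₁ : Finset B, A ⊂ B₁ → 0 < delta k α B₁ - delta k α A) :
    ∃ ε : ℝ, 0 < ε ∧ ∀ B₁ : Finset B, A ⊂ B₁ → ε ≤ delta k α B₁ - delta k α A := by
  rcases (Finset.univ.filter fun B₁ : Finset B => A ⊂ B₁).eq_empty_or_nonempty with h | h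
  · exact ⟨1, one_pos, fun B₁ hB₁ => absurd hB₁ (Finset.filter_eq_empty_iff.1 h
      (Finset.mem_univ B₁))⟩
  · obtain ⟨B₀, hB₀, hmin⟩ :=
      Finset.exists_min_image _ (fun B₁ => delta k α B₁ - delta k α A) h
    exact ⟨_, hstrong B₀ (Finset.mem_filter.1 hB₀).2, fun B₁ hB₁ =>
      hmin B₁ (Finset.mem_filter.2 ⟨Finset.mem_univ _, hB₁⟩)⟩

end Estimates

lemma pev_mono {k : Fin p → ℕ} {α γ : Fin p → ℝ} (hα : ∀ i, 0 < α i ∧ α i ≤ 1)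
    (hγ : ∀ i, 0 < γ i ∧ γ i ≤ 1) {n : ℕ} (hn : 1 ≤ n) {Q Q' : Config p n → Prop}
    (h : ∀ E, Q E → Q' E) : Pev k α γ n Q ≤ Pev k α γ n Q' := by
  refine Finset.sum_le_sum fun E _ => ?_
  by_cases hQ : Q E
  · rw [if_pos hQ, if_pos (h E hQ)]
  · rw [if_neg hQ]
    split_ifs
    · exact weight_nonneg hα hγ hn E
    · exact le_rfl

-- STATEMENT 18
theorem counting_extensions (k : Fin p → ℕ) (α γ : Fin p → ℝ)
    (hα : ∀ i, 0 < α i ∧ α i ≤ 1) (hγ : ∀ i, 0 < γ i ∧ γ i ≤ 1) (hirr : IrrHyp α)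
    (B : Type) [Fintype B] [(Lang p k).Structure B] (hB : InKalpha k α B)
    (A : Finset B) (hA : A ≠ Finset.univ)
    (hstrong : ∀ B₁ : Finset B, A ⊂ B₁ → 0 < delta k α B₁ - delta k α A) :
    ∃ c₁ : ℝ, Tendsto (fun n => Pev k α γ n (fun E =>
        ∀ f : B → Fin n, Set.InjOn f ↑A →
          (n : ℝ) ^ (delta k α (Finset.univ : Finset B) - delta k α A) *
              (Real.log n) ^ (-(((Finset.univ \ A).card : ℝ) + 1)) < (NHom k E A f : ℝ) ∧
            (NHom k E A f : ℝ) <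
              c₁ * (n : ℝ) ^ (delta k α (Finset.univ : Finset B) - delta k α A)))
      atTop (𝓝 1) := by
  obtain ⟨ε, hε0, hε⟩ := exists_pos_le_delta_sub k α A hstrong
  obtain ⟨C, hC⟩ := le_pev_forall_abs_sub_meanExt_lt hα hγ hε0 hε
  set c := (∏ e ∈ relEdges k A, γ e.1) / 2 ^ (Finset.univ \ A).card with hc
  have hc0 : 0 < c := div_pos (Finset.prod_pos fun e _ => (hγ e.1).1) (by positivity)
  refine ⟨2, ?_⟩
  have hlow : Tendsto (fun n : ℕ => 1 - C * (n : ℝ)⁻¹) atTop (𝓝 1) := by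
    simpa using (tendsto_const_nhds (x := (1 : ℝ))).sub
      ((tendsto_inv_atTop_nhds_zero_nat (𝕜 := ℝ)).const_mul C)
  have hlog : ∀ᶠ n : ℕ in atTop,
      (Real.log n) ^ (-(((Finset.univ \ A).card : ℝ) + 1)) < c / 2 :=
    ((tendsto_rpow_neg_atTop (by positivity)).comp
      (Real.tendsto_log_atTop.comp tendsto_natCast_atTop_atTop)).eventually_lt_const
        (by positivity)
  refine tendsto_of_tendsto_of_tendsto_of_le_of_le' hlow tendsto_const_nhds ?_ ?_
  · filter_upwards [hlog, eventually_ge_atTop 1, eventually_ge_atTop (2 * Fintype.card B)]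
      with n hlogn hn hn'
    refine (hC n hn hn').trans (pev_mono hα hγ hn fun E hE f hf => ?_)
    have hnd : 0 < (n : ℝ) ^ (delta k α (Finset.univ : Finset B) - delta k α A) :=
      Real.rpow_pos_of_pos (by exact_mod_cast hn) _
    have habs := abs_lt.1 (hE f hf)
    have hlower := le_meanExt (k := k) (α := α) hγ hn hn' A f hf
    have hupper := meanExt_le (k := k) (α := α) hγ hn A f
    have := mul_lt_mul_of_pos_left hlogn hnd
    constructor <;> linarith
  · filter_upwards [eventually_ge_atTop 1] with n hn
    exact pev_le_one hα hγ hn _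
end
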